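/- arXiv:2110.05918 — 5 statements merged into one kernel-verified Lean document; each statement's English description precedes it below -/
import Mathlib

section
/- Fix λ ∈ (-1/2, ∞), λ ≠ 0, and for n ≥ 0 let L3(λ,n) = ∫_{-1}^{1} K_n^λ(x,x) · log(1/(1-x²)) · w^λ(x) dx. Then L3(λ,n) = (n+1)·( ψ(n+λ+1) - ψ(λ+1/2) ) - (n+2λ)·( ψ(n+λ+1/2) - ψ(λ+1/2) - 2·ψ(2n+2λ+1) + 2·ψ(n+2λ+1) ), where ψ is the digamma function (the logarithmic derivative of the Gamma function). -/
open Real MeasureTheory Finset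

/-- Gegenbauer polynomials `C_n^λ`, defined by `C_0^λ(x) = 1`, `C_1^λ(x) = 2λx` and the
recurrence `n·C_n^λ(x) = 2(n+λ-1)·x·C_{n-1}^λ(x) - (n+2λ-2)·C_{n-2}^λ(x)`. -/
noncomputable def Geg (lam : ℝ) : ℕ → ℝ → ℝ
  | 0, _ => 1
  | 1, x => 2 * lam * x
  | (n + 2), x =>
      (2 * ((n : ℝ) + 1 + lam) * x * Geg lam (n + 1) x
        - ((n : ℝ) + 2 * lam) * Geg lam n x) / ((n : ℝ) + 2)

/-- The Gegenbauer weight `w^λ(x) = Γ(λ+1)/(√π·Γ(λ+1/2))·(1-x²)^{λ-1/2}`. -/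
noncomputable def wG (lam : ℝ) (x : ℝ) : ℝ :=
  Real.Gamma (lam + 1) / (Real.sqrt Real.pi * Real.Gamma (lam + 1 / 2)) *
    (1 - x ^ 2) ^ (lam - 1 / 2)

/-- Normalization constant `γ_n^λ = √(n!·(n+λ)/(λ·(2λ)_n))`. -/
noncomputable def gamG (lam : ℝ) (n : ℕ) : ℝ :=
  Real.sqrt ((n.factorial : ℝ) * ((n : ℝ) + lam) /
    (lam * (ascPochhammer ℝ n).eval (2 * lam)))

/-- Normalized Gegenbauer polynomials `Ĉ_n^λ = γ_n^λ·C_n^λ`. -/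
noncomputable def GegHat (lam : ℝ) (n : ℕ) (x : ℝ) : ℝ := gamG lam n * Geg lam n x

/-- The Gegenbauer projection kernel `K_n^λ(x,y) = ∑_{j=0}^n Ĉ_j^λ(x)Ĉ_j^λ(y)`. -/
noncomputable def KG (lam : ℝ) (n : ℕ) (x y : ℝ) : ℝ :=
  ∑ j ∈ Finset.range (n + 1), GegHat lam j x * GegHat lam j y


/-- `L3(λ,n) = ∫ K_n^λ(x,x)·log(1/(1-x²))·w^λ(x) dx`. -/
noncomputable def L3 (lam : ℝ) (n : ℕ) : ℝ :=
  ∫ x in Set.Icc (-1 : ℝ) 1, KG lam n x x * Real.log (1 / (1 - x ^ 2)) * wG lam x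

/-- The digamma function `ψ = Γ'/Γ`. -/
noncomputable def psi (x : ℝ) : ℝ := deriv Real.Gamma x / Real.Gamma x


lemma aux_pos {x : ℝ} (hx : x ∈ Set.Ioo (-1 : ℝ) 1) : 0 < 1 - x ^ 2 := by
  have h1 := hx.1
  have h2 := hx.2
  nlinarith

lemma aux_le {x : ℝ} : 1 - x ^ 2 ≤ 1 := by nlinarith [sq_nonneg x]

lemma aux_beta (a : ℝ) (ha : 0 < a) :
    ∫ t in (0 : ℝ)..1, t ^ (a - 1) * (1 - t) ^ (a - 1) =
      Real.Gamma a * Real.Gamma a / Real.Gamma (a + a) := by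
  have h := ProbabilityTheory.beta_eq_betaIntegralReal a a ha ha
  rw [ProbabilityTheory.beta] at h
  rw [h, Complex.betaIntegral]
  have : ∫ x in (0 : ℝ)..1, (x : ℂ) ^ ((a : ℂ) - 1) * (1 - (x : ℂ)) ^ ((a : ℂ) - 1) =
      ((∫ t in (0 : ℝ)..1, t ^ (a - 1) * (1 - t) ^ (a - 1) : ℝ) : ℂ) := by
    rw [← intervalIntegral.integral_ofReal]
    apply intervalIntegral.integral_congr
    intro x hx
    rw [Set.uIcc_of_le zero_le_one] at hx
    simp only
    rw [Complex.ofReal_mul, Complex.ofReal_cpow hx.1, Complex.ofReal_cpow (by linarith [hx.2])]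
    push_cast
    rfl
  rw [this, Complex.ofReal_re]

lemma aux_W (s : ℝ) (hs : -(1 / 2) < s) :
    ∫ x in (-1 : ℝ)..1, (1 - x ^ 2) ^ (s - 1 / 2) =
      √π * Real.Gamma (s + 1 / 2) / Real.Gamma (s + 1) := by
  have h1 := intervalIntegral.integral_comp_mul_sub (a := 0) (b := 1)
    (fun x : ℝ => (1 - x ^ 2) ^ (s - 1 / 2)) (c := 2) two_ne_zero 1
  have h2 : ∫ t in (0 : ℝ)..1, (1 - (2 * t - 1) ^ 2) ^ (s - 1 / 2) =
      4 ^ (s - 1 / 2) * (Real.Gamma (s + 1 / 2) * Real.Gamma (s + 1 / 2) /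
        Real.Gamma (s + 1 / 2 + (s + 1 / 2))) := by
    rw [← aux_beta (s + 1 / 2) (by linarith), ← intervalIntegral.integral_const_mul]
    apply intervalIntegral.integral_congr
    intro t ht
    rw [Set.uIcc_of_le zero_le_one] at ht
    have e : 1 - (2 * t - 1) ^ 2 = 4 * (t * (1 - t)) := by ring
    have ht1 : 0 ≤ 1 - t := by linarith [ht.2]
    simp only
    rw [e, Real.mul_rpow (by norm_num) (mul_nonneg ht.1 ht1), Real.mul_rpow ht.1 ht1]
    congr 2 <;> ring_nf
  rw [h2] at h1
  have h3 := Real.Gamma_mul_Gamma_add_half (s + 1 / 2)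
  have e1 : s + 1 / 2 + 1 / 2 = s + 1 := by ring
  have e2 : s + 1 / 2 + (s + 1 / 2) = 2 * (s + 1 / 2) := by ring
  rw [e1] at h3
  rw [e2] at h1
  have g1 := Real.Gamma_pos_of_pos (show 0 < s + 1 by linarith)
  have g2 := Real.Gamma_pos_of_pos (show 0 < 2 * (s + 1 / 2) by linarith)
  have p1 : (4 : ℝ) ^ (s - 1 / 2) = (2 : ℝ) ^ (2 * (s + 1 / 2)) / 4 := by
    rw [show (4 : ℝ) = 2 ^ (2 : ℝ) by norm_num, ← Real.rpow_mul (by norm_num),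
      ← Real.rpow_sub (by norm_num)]
    congr 1
    ring
  have p2 : (2 : ℝ) ^ (1 - 2 * (s + 1 / 2)) = 2 / (2 : ℝ) ^ (2 * (s + 1 / 2)) := by
    rw [Real.rpow_sub (by norm_num), Real.rpow_one]
  have p3 : (0 : ℝ) < (2 : ℝ) ^ (2 * (s + 1 / 2)) := by positivity
  rw [p1] at h1
  rw [p2] at h3
  rw [show (2 : ℝ) * 0 - 1 = -1 by norm_num, show (2 : ℝ) * 1 - 1 = 1 by norm_num,
    smul_eq_mul] at h1
  rw [eq_div_iff g1.ne']
  generalize (2 : ℝ) ^ (2 * (s + 1 / 2)) = P at *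
  generalize (∫ x in (-1 : ℝ)..1, (1 - x ^ 2) ^ (s - 1 / 2)) = I at *
  generalize Real.Gamma (s + 1) = G1 at *
  generalize Real.Gamma (s + 1 / 2) = G0 at *
  generalize Real.Gamma (2 * (s + 1 / 2)) = G2 at *
  field_simp at h1 h3
  have hP : I * G1 * G2 = √π * G0 * G2 := by
    linear_combination (-G1 / 4) * h1 + (1 / 2) * G0 * h3
  exact mul_right_cancel₀ g2.ne' hP

lemma aux_Wint (s : ℝ) (hs : -(1 / 2) < s) :
    IntervalIntegrable (fun x : ℝ => (1 - x ^ 2) ^ (s - 1 / 2)) volume (-1) 1 := by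
  by_contra h
  have := aux_W s hs
  rw [intervalIntegral.integral_undef h] at this
  have g1 := Real.Gamma_pos_of_pos (show 0 < s + 1 by linarith)
  have g2 := Real.Gamma_pos_of_pos (show 0 < s + 1 / 2 by linarith)
  have : 0 < √π * Real.Gamma (s + 1 / 2) / Real.Gamma (s + 1) := by positivity
  linarith

lemma aux_ae : ∀ᵐ x : ℝ ∂volume, x ∈ Set.uIoc (-1 : ℝ) 1 → x ∈ Set.Ioo (-1 : ℝ) 1 := by
  have : ∀ᵐ x : ℝ ∂volume, x ≠ 1 := by
    simp [ae_iff]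
  filter_upwards [this] with x hx hx2
  rw [Set.uIoc_of_le (by norm_num)] at hx2
  exact ⟨hx2.1, lt_of_le_of_ne hx2.2 hx⟩

lemma aux_WLint (s : ℝ) (hs : -(1 / 2) < s) :
    IntervalIntegrable (fun x : ℝ => (1 - x ^ 2) ^ (s - 1 / 2) * Real.log (1 - x ^ 2))
      volume (-1) 1 := by
  set ε := (s + 1 / 2) / 2 with hε
  have hε0 : 0 < ε := by rw [hε]; linarith
  have h := (aux_Wint (s - ε) (by rw [hε]; linarith)).const_mul (1 / ε)
  refine h.mono_fun (Measurable.aestronglyMeasurable (by fun_prop)) ?_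
  rw [Filter.EventuallyLE, ae_restrict_iff' measurableSet_uIoc]
  filter_upwards [aux_ae] with x hx hx2
  have hp := aux_pos (hx hx2)
  have hl := (Real.abs_log_mul_self_rpow_lt (1 - x ^ 2) ε hp aux_le hε0).le
  have e : (1 - x ^ 2) ^ (s - 1 / 2) = (1 - x ^ 2) ^ (s - ε - 1 / 2) * (1 - x ^ 2) ^ ε := by
    rw [← Real.rpow_add hp]; congr 1; ring
  have hq : 0 < (1 - x ^ 2) ^ (s - ε - 1 / 2) := by positivity
  rw [e, mul_assoc, mul_comm ((1 - x ^ 2) ^ ε), norm_mul, norm_mul (1 / ε),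
    Real.norm_eq_abs (Real.log _ * _), Real.norm_of_nonneg (show 0 ≤ 1 / ε by positivity),
    mul_comm]
  gcongr

lemma aux_deriv (s : ℝ) (hs : -(1 / 2) < s) :
    HasDerivAt (fun s : ℝ => ∫ x in (-1 : ℝ)..1, (1 - x ^ 2) ^ (s - 1 / 2))
      (∫ x in (-1 : ℝ)..1, (1 - x ^ 2) ^ (s - 1 / 2) * Real.log (1 - x ^ 2)) s := by
  set s1 := (s - 1 / 2) / 2 with hs1
  have h1 : -(1 / 2) < s1 := by rw [hs1]; linarith
  have h2 : s1 < s := by rw [hs1]; linarith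
  refine (intervalIntegral.hasDerivAt_integral_of_dominated_loc_of_deriv_le
    (F := fun (s : ℝ) (x : ℝ) => (1 - x ^ 2) ^ (s - 1 / 2))
    (F' := fun (s : ℝ) (x : ℝ) => (1 - x ^ 2) ^ (s - 1 / 2) * Real.log (1 - x ^ 2))
    (bound := fun x : ℝ => ‖(1 - x ^ 2) ^ (s1 - 1 / 2) * Real.log (1 - x ^ 2)‖)
    (Ioi_mem_nhds h2) ?_ (aux_Wint s hs) ?_ ?_ (aux_WLint s1 h1).norm ?_).2
  · exact Filter.Eventually.of_forall fun t => Measurable.aestronglyMeasurable (by fun_prop)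
  · exact Measurable.aestronglyMeasurable (by fun_prop)
  · filter_upwards [aux_ae] with x hx hx2 t ht
    have hp := aux_pos (hx hx2)
    rw [norm_mul, norm_mul]
    gcongr
    rw [Real.norm_of_nonneg (by positivity), Real.norm_of_nonneg (by positivity)]
    exact Real.rpow_le_rpow_of_exponent_ge hp aux_le (by linarith [Set.mem_Ioi.1 ht])
  · filter_upwards [aux_ae] with x hx hx2 t ht
    have hp := aux_pos (hx hx2)
    have := (((hasDerivAt_id t).sub_const (1 / 2)).const_rpow hp)
    refine this.congr_deriv ?_
    simp only [id]
    ring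

lemma aux_psi {x : ℝ} (hx : 0 < x) : HasDerivAt Real.Gamma (psi x * Real.Gamma x) x := by
  have h : DifferentiableAt ℝ Real.Gamma x :=
    Real.differentiableAt_Gamma fun m => by
      have : (0 : ℝ) ≤ m := Nat.cast_nonneg m
      linarith
  rw [psi, div_mul_cancel₀ _ (Real.Gamma_pos_of_pos hx).ne']
  exact h.hasDerivAt

lemma aux_psi_succ {x : ℝ} (hx : 0 < x) : psi (x + 1) = psi x + 1 / x := by
  have h1 : HasDerivAt (fun y => Real.Gamma (y + 1)) (psi (x + 1) * Real.Gamma (x + 1)) x :=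
    (aux_psi (show 0 < x + 1 by linarith)).comp_add_const x 1
  have h2 := (hasDerivAt_id x).mul (aux_psi hx)
  have h3 : (fun y => Real.Gamma (y + 1)) =ᶠ[nhds x] (id * Real.Gamma) := by
    filter_upwards [Ioi_mem_nhds hx] with y hy
    exact Real.Gamma_add_one (ne_of_gt hy)
  have h4 := h1.unique (h2.congr_of_eventuallyEq h3)
  rw [Real.Gamma_add_one hx.ne'] at h4
  have g := Real.Gamma_pos_of_pos hx
  simp only [id] at h4
  field_simp
  apply mul_right_cancel₀ g.ne'
  linarith

lemma aux_I0 (s : ℝ) (hs : -(1 / 2) < s) :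
    ∫ x in (-1 : ℝ)..1, (1 - x ^ 2) ^ (s - 1 / 2) * Real.log (1 - x ^ 2) =
      √π * Real.Gamma (s + 1 / 2) / Real.Gamma (s + 1) * (psi (s + 1 / 2) - psi (s + 1)) := by
  have g1 := Real.Gamma_pos_of_pos (show 0 < s + 1 by linarith)
  have h1 : HasDerivAt (fun y => Real.Gamma (y + 1)) (psi (s + 1) * Real.Gamma (s + 1)) s :=
    (aux_psi (show 0 < s + 1 by linarith)).comp_add_const s 1
  have h2 : HasDerivAt (fun y => Real.Gamma (y + 1 / 2))
      (psi (s + 1 / 2) * Real.Gamma (s + 1 / 2)) s :=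
    (aux_psi (show 0 < s + 1 / 2 by linarith)).comp_add_const s (1 / 2)
  have h3 := (h2.const_mul √π).div h1 g1.ne'
  have h4 : (fun s : ℝ => ∫ x in (-1 : ℝ)..1, (1 - x ^ 2) ^ (s - 1 / 2)) =ᶠ[nhds s]
      ((fun y => √π * Real.Gamma (y + 1 / 2)) / fun y => Real.Gamma (y + 1)) := by
    filter_upwards [Ioi_mem_nhds hs] with y hy
    exact aux_W y hy
  rw [(aux_deriv s hs).unique (h3.congr_of_eventuallyEq h4)]
  field_simp

lemma aux_tend {c : ℝ} (hc : c = -1 ∨ c = 1) {F : Filter ℝ} (hF : F ≤ nhds c)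
    (hF2 : ∀ᶠ x in F, x ∈ Set.Ioo (-1 : ℝ) 1) :
    Filter.Tendsto (fun x : ℝ => 1 - x ^ 2) F (nhdsWithin 0 (Set.Ioi 0)) := by
  rw [tendsto_nhdsWithin_iff]
  constructor
  · have : Filter.Tendsto (fun x : ℝ => 1 - x ^ 2) (nhds c) (nhds (1 - c ^ 2)) :=
      Continuous.tendsto (by fun_prop) c
    have e : 1 - c ^ 2 = 0 := by rcases hc with rfl | rfl <;> norm_num
    rw [e] at this
    exact this.mono_left hF
  · filter_upwards [hF2] with x hx
    exact aux_pos hx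

lemma aux_left : ∀ᶠ x in nhdsWithin (-1 : ℝ) (Set.Ioi (-1)), x ∈ Set.Ioo (-1 : ℝ) 1 :=
  Ioo_mem_nhdsGT (by norm_num)

lemma aux_right : ∀ᶠ x in nhdsWithin (1 : ℝ) (Set.Iio 1), x ∈ Set.Ioo (-1 : ℝ) 1 :=
  Ioo_mem_nhdsLT (by norm_num)

lemma aux_int1 (lam : ℝ) (hlam : -(1 / 2) < lam) {f : ℝ → ℝ} (hf : Continuous f) :
    IntervalIntegrable (fun x : ℝ => f x * (1 - x ^ 2) ^ (lam - 1 / 2)) volume (-1) 1 :=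
  (aux_Wint lam hlam).continuousOn_mul hf.continuousOn

lemma aux_int2 (lam : ℝ) (hlam : -(1 / 2) < lam) {f : ℝ → ℝ} (hf : Continuous f) :
    IntervalIntegrable (fun x : ℝ => f x * ((1 - x ^ 2) ^ (lam - 1 / 2) * Real.log (1 - x ^ 2)))
      volume (-1) 1 :=
  (aux_WLint lam hlam).continuousOn_mul hf.continuousOn

lemma aux_ibp (lam : ℝ) (hlam : -(1 / 2) < lam) (q q' r : ℝ → ℝ)
    (hq : ∀ x, HasDerivAt q (q' x) x) (hr : Continuous r)
    (h : ∀ x, (1 - x ^ 2) * q' x - (2 * lam + 1) * x * q x = r x) :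
    (∫ x in (-1 : ℝ)..1, r x * (1 - x ^ 2) ^ (lam - 1 / 2)) = 0 ∧
    (∫ x in (-1 : ℝ)..1, r x * ((1 - x ^ 2) ^ (lam - 1 / 2) * Real.log (1 - x ^ 2))) =
      ∫ x in (-1 : ℝ)..1, (2 * x * q x) * (1 - x ^ 2) ^ (lam - 1 / 2) := by
  have hqc : Continuous q := continuous_iff_continuousAt.2 fun x => (hq x).continuousAt
  have hp : 0 < lam + 1 / 2 := by linarith
  have hu : ∀ x : ℝ, HasDerivAt (fun x : ℝ => 1 - x ^ 2) (-(2 * x)) x := fun x => by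
    have := ((hasDerivAt_id x).pow 2).const_sub 1
    refine this.congr_deriv ?_
    simp
  have hrw : ∀ x : ℝ, 0 < 1 - x ^ 2 →
      (1 - x ^ 2) ^ (lam + 1 / 2) = (1 - x ^ 2) * (1 - x ^ 2) ^ (lam - 1 / 2) := fun x hx => by
    rw [mul_comm, ← Real.rpow_add_one hx.ne']
    congr 1
    ring
  have hW : ∀ x ∈ Set.Ioo (-1 : ℝ) 1, HasDerivAt (fun x : ℝ => (1 - x ^ 2) ^ (lam + 1 / 2))
      (-(2 * lam + 1) * x * (1 - x ^ 2) ^ (lam - 1 / 2)) x := fun x hx => by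
    have := (hu x).rpow_const (p := lam + 1 / 2) (Or.inl (aux_pos hx).ne')
    refine this.congr_deriv ?_
    rw [show lam + 1 / 2 - 1 = lam - 1 / 2 by ring]
    ring
  have tq : ∀ (c : ℝ) (F : Filter ℝ), F ≤ nhds c → Filter.Tendsto q F (nhds (q c)) :=
    fun c F hF => (hqc.tendsto c).mono_left hF
  have t0 : Filter.Tendsto (fun u : ℝ => u ^ (lam + 1 / 2)) (nhdsWithin 0 (Set.Ioi 0))
      (nhds 0) := by
    have := (Real.continuous_rpow_const hp.le).tendsto 0
    rw [Real.zero_rpow hp.ne'] at this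
    exact this.mono_left nhdsWithin_le_nhds
  have t1 := tendsto_log_mul_rpow_nhdsGT_zero hp
  have key1 : ∀ (c : ℝ) (F : Filter ℝ), (c = -1 ∨ c = 1) → F ≤ nhds c →
      (∀ᶠ x in F, x ∈ Set.Ioo (-1 : ℝ) 1) →
      Filter.Tendsto (fun x => q x * (1 - x ^ 2) ^ (lam + 1 / 2)) F (nhds 0) ∧
      Filter.Tendsto (fun x => q x * (Real.log (1 - x ^ 2) * (1 - x ^ 2) ^ (lam + 1 / 2)))
        F (nhds 0) := by
    intro c F hc hF hF2
    have a := aux_tend hc hF hF2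
    constructor
    · simpa using! (tq c F hF).mul (t0.comp a)
    · simpa using! (tq c F hF).mul (t1.comp a)
  have kl := key1 (-1) _ (Or.inl rfl) nhdsWithin_le_nhds aux_left
  have kr := key1 1 _ (Or.inr rfl) nhdsWithin_le_nhds aux_right
  have i1 := aux_int1 lam hlam hr
  have i2 := aux_int2 lam hlam hr
  have i3 := aux_int1 lam hlam (f := fun x => 2 * x * q x) (by fun_prop)
  constructor
  · rw [intervalIntegral.integral_eq_sub_of_hasDerivAt_of_tendsto (by norm_num) ?_ i1 kl.1 kr.1,
      sub_zero]
    intro x hx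
    refine ((hq x).mul (hW x hx)).congr_deriv ?_
    rw [hrw x (aux_pos hx), ← h x]
    ring
  · rw [← sub_eq_zero, ← intervalIntegral.integral_sub i2 i3,
      intervalIntegral.integral_eq_sub_of_hasDerivAt_of_tendsto (by norm_num) ?_
        (i2.sub i3) kl.2 kr.2, sub_zero]
    intro x hx
    have hp := aux_pos hx
    refine ((hq x).mul (((hu x).log hp.ne').mul (hW x hx))).congr_deriv ?_
    simp only [Pi.mul_apply]
    rw [hrw x hp, ← h x]
    field_simp
    ring

/-- Derivative of the Gegenbauer polynomials, by recursion. -/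
noncomputable def dGeg (lam : ℝ) : ℕ → ℝ → ℝ
  | 0, _ => 0
  | 1, _ => 2 * lam
  | (n + 2), x =>
      (2 * ((n : ℝ) + 1 + lam) * (Geg lam (n + 1) x + x * dGeg lam (n + 1) x)
        - ((n : ℝ) + 2 * lam) * dGeg lam n x) / ((n : ℝ) + 2)

/-- The Christoffel-Darboux kernel on the diagonal, unnormalized. -/
noncomputable def kk (lam : ℝ) : ℕ → ℝ → ℝ
  | 0, _ => 2 * lam
  | (n + 1), x =>
      (2 * ((n : ℝ) + 1 + lam) * Geg lam (n + 1) x ^ 2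
        + ((n : ℝ) + 2 * lam) * kk lam n x) / ((n : ℝ) + 2)

/-- Derivative of `kk`. -/
noncomputable def dkk (lam : ℝ) : ℕ → ℝ → ℝ
  | 0, _ => 0
  | (n + 1), x =>
      (2 * ((n : ℝ) + 1 + lam) * (2 * Geg lam (n + 1) x * dGeg lam (n + 1) x)
        + ((n : ℝ) + 2 * lam) * dkk lam n x) / ((n : ℝ) + 2)

lemma n2_ne (n : ℕ) : (n : ℝ) + 2 ≠ 0 := by positivity

lemma Geg_rec (lam : ℝ) (n : ℕ) (x : ℝ) : ((n : ℝ) + 2) * Geg lam (n + 2) x =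
    2 * ((n : ℝ) + 1 + lam) * x * Geg lam (n + 1) x - ((n : ℝ) + 2 * lam) * Geg lam n x := by
  rw [Geg]
  exact mul_div_cancel₀ _ (n2_ne n)

lemma dGeg_rec (lam : ℝ) (n : ℕ) (x : ℝ) : ((n : ℝ) + 2) * dGeg lam (n + 2) x =
    2 * ((n : ℝ) + 1 + lam) * (Geg lam (n + 1) x + x * dGeg lam (n + 1) x)
      - ((n : ℝ) + 2 * lam) * dGeg lam n x := by
  rw [dGeg]
  exact mul_div_cancel₀ _ (n2_ne n)

lemma kk_rec (lam : ℝ) (n : ℕ) (x : ℝ) : ((n : ℝ) + 2) * kk lam (n + 1) x =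
    2 * ((n : ℝ) + 1 + lam) * Geg lam (n + 1) x ^ 2 + ((n : ℝ) + 2 * lam) * kk lam n x := by
  rw [kk]
  exact mul_div_cancel₀ _ (n2_ne n)

lemma dkk_rec (lam : ℝ) (n : ℕ) (x : ℝ) : ((n : ℝ) + 2) * dkk lam (n + 1) x =
    2 * ((n : ℝ) + 1 + lam) * (2 * Geg lam (n + 1) x * dGeg lam (n + 1) x)
      + ((n : ℝ) + 2 * lam) * dkk lam n x := by
  rw [dkk]
  exact mul_div_cancel₀ _ (n2_ne n)

lemma Geg_deriv (lam : ℝ) (n : ℕ) : (∀ x, HasDerivAt (Geg lam n) (dGeg lam n x) x) ∧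
    (∀ x, HasDerivAt (Geg lam (n + 1)) (dGeg lam (n + 1) x) x) := by
  induction n with
  | zero =>
    refine ⟨fun x => ?_, fun x => ?_⟩
    · have : Geg lam 0 = fun _ => 1 := by funext y; simp [Geg]
      rw [this]
      simpa [dGeg] using hasDerivAt_const x (1 : ℝ)
    · have : Geg lam (0 + 1) = fun y => 2 * lam * y := by funext y; simp [Geg]
      rw [this]
      simpa [dGeg] using (hasDerivAt_id x).const_mul (2 * lam)
  | succ n ih =>
    refine ⟨ih.2, fun x => ?_⟩
    have : Geg lam (n + 1 + 1) = fun x => (2 * ((n : ℝ) + 1 + lam) * (x * Geg lam (n + 1) x)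
        - ((n : ℝ) + 2 * lam) * Geg lam n x) / ((n : ℝ) + 2) := by
      funext y; rw [Geg]; ring
    rw [this]
    refine (((((hasDerivAt_id x).mul (ih.2 x)).const_mul _).sub
      ((ih.1 x).const_mul _)).div_const _).congr_deriv ?_
    rw [dGeg]
    simp only [id]
    ring

lemma kk_deriv (lam : ℝ) (n : ℕ) : ∀ x, HasDerivAt (kk lam n) (dkk lam n x) x := by
  induction n with
  | zero =>
    intro x
    have : kk lam 0 = fun _ => 2 * lam := by funext y; simp [kk]
    rw [this]
    simpa [dkk] using hasDerivAt_const x (2 * lam)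
  | succ n ih =>
    intro x
    have : kk lam (n + 1) = fun x => (2 * ((n : ℝ) + 1 + lam) * (Geg lam (n + 1) x ^ 2)
        + ((n : ℝ) + 2 * lam) * kk lam n x) / ((n : ℝ) + 2) := by
      funext y; rw [kk]
    rw [this]
    refine ((((((Geg_deriv lam n).2 x).pow 2).const_mul _).add
      ((ih x).const_mul _)).div_const _).congr_deriv ?_
    rw [dkk]
    simp

lemma Geg_cont (lam : ℝ) (n : ℕ) : Continuous (Geg lam n) :=
  continuous_iff_continuousAt.2 fun x => ((Geg_deriv lam n).1 x).continuousAt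

lemma kk_cont (lam : ℝ) (n : ℕ) : Continuous (kk lam n) :=
  continuous_iff_continuousAt.2 fun x => (kk_deriv lam n x).continuousAt

lemma Geg_id (lam : ℝ) (n : ℕ) (x : ℝ) :
    (1 - x ^ 2) * dGeg lam n x = ((n : ℝ) + 2 * lam) * x * Geg lam n x
      - ((n : ℝ) + 1) * Geg lam (n + 1) x ∧
    (1 - x ^ 2) * dGeg lam (n + 1) x = -((n : ℝ) + 1) * x * Geg lam (n + 1) x
      + ((n : ℝ) + 2 * lam) * Geg lam n x := by
  induction n with
  | zero =>
    constructor <;> simp [Geg, dGeg] <;> ring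
  | succ n ih =>
    obtain ⟨h1, h2⟩ := ih
    have r1 := Geg_rec lam n x
    have r2 := dGeg_rec lam n x
    push_cast
    constructor
    · linear_combination h2 + r1
    · apply mul_left_cancel₀ (n2_ne n)
      rw [show n + 1 + 1 = n + 2 by rfl]
      linear_combination (1 - x ^ 2) * r2 + (2 * ((n : ℝ) + 1 + lam) * x) * h2
        - ((n : ℝ) + 2 * lam) * h1 + ((n : ℝ) + 2) * x * r1

lemma kk_id1 (lam : ℝ) (n : ℕ) (x : ℝ) :
    (1 - x ^ 2) * dkk lam n x = (2 * lam + 1) * x * kk lam n x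
      - (2 * n + 1 + 2 * lam) * Geg lam n x * Geg lam (n + 1) x := by
  induction n with
  | zero => simp [Geg, kk, dkk]; ring
  | succ n ih =>
    have h2 := (Geg_id lam n x).2
    have r1 := Geg_rec lam n x
    have r2 := kk_rec lam n x
    have r3 := dkk_rec lam n x
    push_cast
    apply mul_left_cancel₀ (n2_ne n)
    rw [show n + 1 + 1 = n + 2 by rfl]
    linear_combination (1 - x ^ 2) * r3 + ((n : ℝ) + 2 * lam) * ih
      + 4 * ((n : ℝ) + 1 + lam) * Geg lam (n + 1) x * h2 - (2 * lam + 1) * x * r2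
      + (2 * n + 3 + 2 * lam) * Geg lam (n + 1) x * r1

lemma kk_id2 (lam : ℝ) (n : ℕ) (x : ℝ) :
    (1 - x ^ 2) * kk lam n x = ((n : ℝ) + 1) * Geg lam (n + 1) x ^ 2
      + ((n : ℝ) + 2 * lam) * Geg lam n x ^ 2
      - (2 * n + 2 * lam + 1) * x * Geg lam n x * Geg lam (n + 1) x := by
  induction n with
  | zero => simp [Geg, kk]; ring
  | succ n ih =>
    have r1 := Geg_rec lam n x
    have r2 := kk_rec lam n x
    push_cast
    apply mul_left_cancel₀ (n2_ne n)
    rw [show n + 1 + 1 = n + 2 by rfl]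
    have e : ((n : ℝ) + 2) ^ 2 * Geg lam (n + 2) x ^ 2 =
      (2 * ((n : ℝ) + 1 + lam) * x * Geg lam (n + 1) x
        - ((n : ℝ) + 2 * lam) * Geg lam n x) ^ 2 := by rw [← r1]; ring
    linear_combination (1 - x ^ 2) * r2 + ((n : ℝ) + 2 * lam) * ih - e
      + (2 * n + 2 * lam + 3) * x * Geg lam (n + 1) x * r1

/-- Squared (unnormalized) norm. -/
noncomputable def hh (lam : ℝ) (n : ℕ) : ℝ :=
  ∫ x in (-1 : ℝ)..1, Geg lam n x ^ 2 * (1 - x ^ 2) ^ (lam - 1 / 2)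

/-- Logarithmic integral. -/
noncomputable def ll (lam : ℝ) (n : ℕ) : ℝ :=
  ∫ x in (-1 : ℝ)..1, Geg lam n x ^ 2 * ((1 - x ^ 2) ^ (lam - 1 / 2) * Real.log (1 - x ^ 2))

/-- Integral of the kernel. -/
noncomputable def ss (lam : ℝ) (n : ℕ) : ℝ :=
  ∫ x in (-1 : ℝ)..1, kk lam n x * (1 - x ^ 2) ^ (lam - 1 / 2)

lemma hl_rec (lam : ℝ) (hlam : -(1 / 2) < lam) (n : ℕ) :
    ((n : ℝ) + 1) * (n + lam + 1) * hh lam (n + 1) = (n + 2 * lam) * (n + lam) * hh lam n ∧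
    ((n : ℝ) + 1) * (n + lam + 1) * ll lam (n + 1) - (n + 2 * lam) * (n + lam) * ll lam n =
      ss lam n - (n + 1) * hh lam (n + 1) - (n + 2 * lam) * hh lam n := by
  have c0 := Geg_cont lam n
  have c1 := Geg_cont lam (n + 1)
  have ck := kk_cont lam n
  have key := aux_ibp lam hlam
    (fun x => x * kk lam n x - (2 * n + 2 * lam + 1) * (Geg lam n x * Geg lam (n + 1) x))
    (fun x => kk lam n x + x * dkk lam n x - (2 * n + 2 * lam + 1) *
      (dGeg lam n x * Geg lam (n + 1) x + Geg lam n x * dGeg lam (n + 1) x))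
    (fun x => (2 * (((n : ℝ) + 1) * (n + lam + 1))) * Geg lam (n + 1) x ^ 2
      - (2 * ((n + 2 * lam) * (n + lam))) * Geg lam n x ^ 2)
    (fun x => by
      refine (((hasDerivAt_id x).mul (kk_deriv lam n x)).sub
        ((((Geg_deriv lam n).1 x).mul ((Geg_deriv lam n).2 x)).const_mul _)).congr_deriv ?_
      simp)
    (by fun_prop)
    (fun x => by
      have h1 := (Geg_id lam n x).1
      have h2 := (Geg_id lam n x).2
      have h3 := kk_id1 lam n x
      have h4 := kk_id2 lam n x
      linear_combination h4 + x * h3 - (2 * n + 2 * lam + 1) * (Geg lam (n + 1) x * h1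
        + Geg lam n x * h2))
  obtain ⟨k1, k2⟩ := key
  have i0 := aux_int1 lam hlam (f := fun x => Geg lam n x ^ 2) (c0.pow 2)
  have i1 := aux_int1 lam hlam (f := fun x => Geg lam (n + 1) x ^ 2) (c1.pow 2)
  have ik := aux_int1 lam hlam ck
  have j0 := aux_int2 lam hlam (f := fun x => Geg lam n x ^ 2) (c0.pow 2)
  have j1 := aux_int2 lam hlam (f := fun x => Geg lam (n + 1) x ^ 2) (c1.pow 2)
  simp only [sub_mul, mul_assoc] at k1
  constructor
  · have e : (∫ x in (-1 : ℝ)..1, ((2 * (((n : ℝ) + 1) * (n + lam + 1))) *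
        (Geg lam (n + 1) x ^ 2 * (1 - x ^ 2) ^ (lam - 1 / 2))
        - (2 * ((n + 2 * lam) * (n + lam))) *
        (Geg lam n x ^ 2 * (1 - x ^ 2) ^ (lam - 1 / 2)))) = 0 := by
      rw [← k1]
      congr 1
      funext x
      ring
    rw [intervalIntegral.integral_sub (i1.const_mul _) (i0.const_mul _),
      intervalIntegral.integral_const_mul, intervalIntegral.integral_const_mul] at e
    rw [hh, hh]
    linarith
  · have e : (∫ x in (-1 : ℝ)..1, ((2 * (((n : ℝ) + 1) * (n + lam + 1))) *
        (Geg lam (n + 1) x ^ 2 * ((1 - x ^ 2) ^ (lam - 1 / 2) * Real.log (1 - x ^ 2)))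
        - (2 * ((n + 2 * lam) * (n + lam))) *
        (Geg lam n x ^ 2 * ((1 - x ^ 2) ^ (lam - 1 / 2) * Real.log (1 - x ^ 2))))) =
        ∫ x in (-1 : ℝ)..1, (2 * (kk lam n x * (1 - x ^ 2) ^ (lam - 1 / 2))
          - (2 * ((n : ℝ) + 1)) * (Geg lam (n + 1) x ^ 2 * (1 - x ^ 2) ^ (lam - 1 / 2))
          - (2 * ((n : ℝ) + 2 * lam)) * (Geg lam n x ^ 2 * (1 - x ^ 2) ^ (lam - 1 / 2))) := by
      refine Eq.trans ?_ (k2.trans ?_)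
      · congr 1
        funext x
        ring
      · congr 1
        funext x
        have h4 := kk_id2 lam n x
        linear_combination (-2) * (1 - x ^ 2) ^ (lam - 1 / 2) * h4
    rw [intervalIntegral.integral_sub (j1.const_mul _) (j0.const_mul _),
      intervalIntegral.integral_sub ((ik.const_mul _).sub (i1.const_mul _)) (i0.const_mul _),
      intervalIntegral.integral_sub (ik.const_mul _) (i1.const_mul _)] at e
    simp only [intervalIntegral.integral_const_mul] at e
    rw [hh, hh, ll, ll, ss]
    linarith

lemma ss_eq (lam : ℝ) (hlam : -(1 / 2) < lam) (n : ℕ) :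
    ss lam n = 2 * (n + lam) * hh lam n := by
  induction n with
  | zero =>
    rw [ss, hh, ← intervalIntegral.integral_const_mul]
    congr 1
    funext x
    simp [kk, Geg]
  | succ n ih =>
    have h := (hl_rec lam hlam n).1
    have i1 := aux_int1 lam hlam (f := fun x => Geg lam (n + 1) x ^ 2)
      ((Geg_cont lam (n + 1)).pow 2)
    have ik := aux_int1 lam hlam (kk_cont lam n)
    have e : ((n : ℝ) + 2) * ss lam (n + 1) =
        2 * ((n : ℝ) + 1 + lam) * hh lam (n + 1) + (n + 2 * lam) * ss lam n := by
      rw [ss, ss, hh, ← intervalIntegral.integral_const_mul,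
        ← intervalIntegral.integral_const_mul, ← intervalIntegral.integral_const_mul,
        ← intervalIntegral.integral_add (i1.const_mul _) (ik.const_mul _)]
      congr 1
      funext x
      linear_combination (1 - x ^ 2) ^ (lam - 1 / 2) * kk_rec lam n x
    apply mul_left_cancel₀ (n2_ne n)
    push_cast
    linear_combination e + (n + 2 * lam) * ih - 2 * h

lemma gam_sq (lam : ℝ) (hlam : -(1 / 2) < lam) (hlam0 : lam ≠ 0) (n : ℕ) :
    gamG lam n ^ 2 = (n.factorial : ℝ) * ((n : ℝ) + lam) /
      (lam * (ascPochhammer ℝ n).eval (2 * lam)) ∧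
    0 < lam * ((n : ℝ) + lam) * (lam * (ascPochhammer ℝ n).eval (2 * lam)) * lam ∧
    0 < ((n : ℝ) + lam) * (lam * (ascPochhammer ℝ n).eval (2 * lam)) := by
  have key : 0 < ((n : ℝ) + lam) * (lam * (ascPochhammer ℝ n).eval (2 * lam)) := by
    induction n with
    | zero => simp; positivity
    | succ n ih =>
      rw [ascPochhammer_succ_eval]
      push_cast
      rcases Nat.eq_zero_or_pos n with rfl | hn
      · simp
        have : 0 < lam ^ 2 := by positivity
        nlinarith
      · have hn1 : (1 : ℝ) ≤ n := by exact_mod_cast hn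
        have p : 0 < lam * (ascPochhammer ℝ n).eval (2 * lam) := by
          by_contra hc
          nlinarith
        have : 0 < (n + 1 + lam) * (lam * (ascPochhammer ℝ n).eval (2 * lam)) * (2 * lam + n) := by
          apply mul_pos (mul_pos _ p) <;> linarith
        linarith
  refine ⟨?_, ?_, key⟩
  · rw [gamG, Real.sq_sqrt]
    rw [mul_div_assoc]
    apply mul_nonneg (by positivity)
    have := (div_pos key (show 0 < (lam * (ascPochhammer ℝ n).eval (2 * lam)) ^ 2 by
      have : lam * (ascPochhammer ℝ n).eval (2 * lam) ≠ 0 := by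
        intro h; rw [h] at key; simp at key
      positivity)).le
    have e : ((n : ℝ) + lam) / (lam * (ascPochhammer ℝ n).eval (2 * lam)) =
      (n + lam) * (lam * (ascPochhammer ℝ n).eval (2 * lam)) /
        (lam * (ascPochhammer ℝ n).eval (2 * lam)) ^ 2 := by
      have : lam * (ascPochhammer ℝ n).eval (2 * lam) ≠ 0 := by
        intro h; rw [h] at key; simp at key
      field_simp
    rw [e]
    exact this
  · have : 0 < lam ^ 2 := by positivity
    nlinarith

lemma nl_ne (lam : ℝ) (hlam : -(1 / 2) < lam) (hlam0 : lam ≠ 0) (n : ℕ) :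
    (n : ℝ) + lam ≠ 0 ∧ (n : ℝ) + 2 * lam ≠ 0 := by
  rcases Nat.eq_zero_or_pos n with rfl | hn
  · simpa using hlam0
  · have hn1 : (1 : ℝ) ≤ n := by exact_mod_cast hn
    constructor <;> apply ne_of_gt <;> linarith

lemma gam_rec (lam : ℝ) (hlam : -(1 / 2) < lam) (hlam0 : lam ≠ 0) (n : ℕ) :
    gamG lam (n + 1) ^ 2 =
      gamG lam n ^ 2 * ((n + 1) * (n + lam + 1)) / ((n + 2 * lam) * (n + lam)) := by
  obtain ⟨a0, -, b0⟩ := gam_sq lam hlam hlam0 n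
  obtain ⟨a1, -, b1⟩ := gam_sq lam hlam hlam0 (n + 1)
  obtain ⟨c1, c2⟩ := nl_ne lam hlam hlam0 n
  have d : (ascPochhammer ℝ n).eval (2 * lam) ≠ 0 := by
    intro h; rw [h] at b0; simp at b0
  rw [a0, a1, ascPochhammer_succ_eval, Nat.factorial_succ, add_comm (2 * lam) (n : ℝ)]
  push_cast
  field_simp
  ring

lemma L3_term (lam : ℝ) (hlam : -(1 / 2) < lam) (hlam0 : lam ≠ 0) (n : ℕ) :
    gamG lam n ^ 2 * hh lam n = √π * Real.Gamma (lam + 1 / 2) / Real.Gamma (lam + 1) ∧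
    gamG lam n ^ 2 * ll lam n = -(√π * Real.Gamma (lam + 1 / 2) / Real.Gamma (lam + 1)) *
      (psi ((n : ℝ) + lam + 1) - psi ((n : ℝ) + lam + 1 / 2) + 2 * psi (2 * (n : ℝ) + 2 * lam + 1)
        - 2 * psi ((n : ℝ) + 2 * lam + 1) - 1 / (n + lam) + 2 / (n + 2 * lam)) := by
  induction n with
  | zero =>
    have h0 : gamG lam 0 ^ 2 = 1 := by
      rw [(gam_sq lam hlam hlam0 0).1]
      simp [hlam0]
    have e1 : hh lam 0 = √π * Real.Gamma (lam + 1 / 2) / Real.Gamma (lam + 1) := by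
      rw [← aux_W lam hlam, hh]
      simp [Geg]
    have e2 := aux_I0 lam hlam
    have e3 : ll lam 0 = ∫ x in (-1 : ℝ)..1, (1 - x ^ 2) ^ (lam - 1 / 2) * Real.log (1 - x ^ 2) := by
      rw [ll]
      simp [Geg]
    rw [h0, e1, e3, e2]
    refine ⟨one_mul _, ?_⟩
    simp only [Nat.cast_zero, zero_add, mul_zero]
    have : 2 / (2 * lam) = 1 / lam := by field_simp
    rw [this]
    ring
  | succ n ih =>
    obtain ⟨i1, i2⟩ := ih
    obtain ⟨r1, r2⟩ := hl_rec lam hlam n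
    rw [ss_eq lam hlam n] at r2
    have g := gam_rec lam hlam hlam0 n
    obtain ⟨c1, c2⟩ := nl_ne lam hlam hlam0 n
    have hn : (0 : ℝ) ≤ n := Nat.cast_nonneg n
    have c3 : (n : ℝ) + lam + 1 ≠ 0 := by apply ne_of_gt; linarith
    have c4 : (n : ℝ) + 2 * lam + 1 ≠ 0 := by apply ne_of_gt; linarith
    have c5 : 2 * (n : ℝ) + 2 * lam + 1 ≠ 0 := by apply ne_of_gt; linarith
    have c6 : (n : ℝ) + 1 ≠ 0 := by positivity
    have hA := aux_psi_succ (show 0 < (n : ℝ) + lam + 1 by linarith)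
    have hB := aux_psi_succ (show 0 < (n : ℝ) + lam + 1 / 2 by linarith)
    have hC := aux_psi_succ (show 0 < 2 * (n : ℝ) + 2 * lam + 1 by linarith)
    have hD := aux_psi_succ (show 0 < 2 * (n : ℝ) + 2 * lam + 1 + 1 by linarith)
    have hE := aux_psi_succ (show 0 < (n : ℝ) + 2 * lam + 1 by linarith)
    have hB' : 1 / ((n : ℝ) + lam + 1 / 2) = 2 / (2 * n + 2 * lam + 1) := by
      rw [div_eq_div_iff (by apply ne_of_gt; linarith) c5]; ring
    have hD' : 1 / (2 * (n : ℝ) + 2 * lam + 1 + 1) = (1 / 2) * (1 / (n + lam + 1)) := by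
      rw [show 2 * (n : ℝ) + 2 * lam + 1 + 1 = 2 * (n + lam + 1) by ring]; field_simp
    set N := √π * Real.Gamma (lam + 1 / 2) / Real.Gamma (lam + 1) with hN
    have f1 : gamG lam (n + 1) ^ 2 * hh lam (n + 1) = N := by
      rw [g, ← i1, div_mul_eq_mul_div, div_eq_iff (mul_ne_zero c2 c1)]
      linear_combination gamG lam n ^ 2 * r1
    refine ⟨f1, ?_⟩
    push_cast
    rw [show (n : ℝ) + 1 + lam + 1 = n + lam + 1 + 1 by ring,
      show (n : ℝ) + 1 + lam + 1 / 2 = n + lam + 1 / 2 + 1 by ring,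
      show 2 * ((n : ℝ) + 1) + 2 * lam + 1 = 2 * n + 2 * lam + 1 + 1 + 1 by ring,
      show (n : ℝ) + 1 + 2 * lam + 1 = n + 2 * lam + 1 + 1 by ring, hA, hB, hD, hC, hE, hB', hD',
      show (n : ℝ) + 1 + lam = n + lam + 1 by ring,
      show (n : ℝ) + 1 + 2 * lam = n + 2 * lam + 1 by ring]
    have f2 : gamG lam (n + 1) ^ 2 * ll lam (n + 1) = gamG lam n ^ 2 * ll lam n
        + N * (2 / (n + 2 * lam) - 1 / (n + lam + 1) - 1 / (n + lam)) := by
      rw [g, ← i1]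
      have r1' : hh lam (n + 1) = (n + 2 * lam) * (n + lam) * hh lam n / ((n + 1) * (n + lam + 1)) := by
        rw [eq_div_iff (mul_ne_zero c6 c3)]; linarith
      have r2' : ll lam (n + 1) = ((n + 2 * lam) * (n + lam) * ll lam n + 2 * (n + lam) * hh lam n
          - (n + 1) * hh lam (n + 1) - (n + 2 * lam) * hh lam n) / ((n + 1) * (n + lam + 1)) := by
        rw [eq_div_iff (mul_ne_zero c6 c3)]; linarith
      rw [r2', r1']
      have key : ∀ A B C D a h l : ℝ, A ≠ 0 → B ≠ 0 → C ≠ 0 → D ≠ 0 →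
          a * (D * C) / (A * B) * ((A * B * l + 2 * B * h - D * (A * B * h / (D * C)) - A * h)
            / (D * C)) = a * l + a * h * (2 / A - 1 / C - 1 / B) := by
        intro A B C D a h l hA hB hC hD
        field_simp
        ring
      exact key _ _ _ _ _ _ _ c2 c1 c3 c6
    rw [f2, i2]
    ring

lemma L3_sum (lam : ℝ) (hlam : -(1 / 2) < lam) (n : ℕ) :
    L3 lam n = ∑ j ∈ Finset.range (n + 1),
      -(Real.Gamma (lam + 1) / (√π * Real.Gamma (lam + 1 / 2))) * (gamG lam j ^ 2 * ll lam j) := by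
  rw [L3, integral_Icc_eq_integral_Ioc, ← intervalIntegral.integral_of_le (by norm_num)]
  have : ∀ x : ℝ, KG lam n x x * Real.log (1 / (1 - x ^ 2)) * wG lam x =
      ∑ j ∈ Finset.range (n + 1),
        (-(Real.Gamma (lam + 1) / (√π * Real.Gamma (lam + 1 / 2))) * gamG lam j ^ 2) *
        (Geg lam j x ^ 2 * ((1 - x ^ 2) ^ (lam - 1 / 2) * Real.log (1 - x ^ 2))) := by
    intro x
    rw [KG, wG, one_div, Real.log_inv, Finset.sum_mul, Finset.sum_mul]
    refine Finset.sum_congr rfl fun j _ => ?_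
    rw [GegHat]
    ring
  simp only [this]
  rw [intervalIntegral.integral_finsetSum]
  · refine Finset.sum_congr rfl fun j _ => ?_
    rw [intervalIntegral.integral_const_mul, ll, mul_assoc]
  · intro j _
    exact (aux_int2 lam hlam (f := fun x => Geg lam j x ^ 2) ((Geg_cont lam j).pow 2)).const_mul _

theorem gegenbauer_L3_exact
    (lam : ℝ) (hlam : -(1 / 2) < lam) (hlam0 : lam ≠ 0) (n : ℕ) :
    L3 lam n =
      ((n : ℝ) + 1) * (psi ((n : ℝ) + lam + 1) - psi (lam + 1 / 2))
        - ((n : ℝ) + 2 * lam) *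
          (psi ((n : ℝ) + lam + 1 / 2) - psi (lam + 1 / 2)
            - 2 * psi (2 * (n : ℝ) + 2 * lam + 1) + 2 * psi ((n : ℝ) + 2 * lam + 1)) := by
  have g1 := Real.Gamma_pos_of_pos (show 0 < lam + 1 by linarith)
  have g2 := Real.Gamma_pos_of_pos (show 0 < lam + 1 / 2 by linarith)
  have g3 : 0 < √π := Real.sqrt_pos.2 Real.pi_pos
  have hT : ∀ j : ℕ,
      -(Real.Gamma (lam + 1) / (√π * Real.Gamma (lam + 1 / 2))) * (gamG lam j ^ 2 * ll lam j) =
      (psi ((j : ℝ) + lam + 1) - psi ((j : ℝ) + lam + 1 / 2) + 2 * psi (2 * (j : ℝ) + 2 * lam + 1)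
        - 2 * psi ((j : ℝ) + 2 * lam + 1) - 1 / (j + lam) + 2 / (j + 2 * lam)) := by
    intro j
    rw [(L3_term lam hlam hlam0 j).2, ← mul_assoc]
    have : -(Real.Gamma (lam + 1) / (√π * Real.Gamma (lam + 1 / 2))) *
        -(√π * Real.Gamma (lam + 1 / 2) / Real.Gamma (lam + 1)) = 1 := by
      clear * - g1 g2 g3
      generalize Real.Gamma (lam + 1 / 2) = G0 at *
      generalize Real.Gamma (lam + 1) = G1 at *
      field_simp
    rw [this, one_mul]
  rw [L3_sum lam hlam n, Finset.sum_congr rfl fun j _ => hT j]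
  clear hT
  induction n with
  | zero =>
    have : 2 / (2 * lam) = 1 / lam := by field_simp
    simp only [Nat.cast_zero, zero_add, mul_zero, Finset.sum_range_one]
    rw [this]
    ring
  | succ n ih =>
    rw [Finset.sum_range_succ, ih]
    have hn : (0 : ℝ) ≤ n := Nat.cast_nonneg n
    have c3 : (n : ℝ) + lam + 1 ≠ 0 := by apply ne_of_gt; linarith
    have c4 : (n : ℝ) + 2 * lam + 1 ≠ 0 := by apply ne_of_gt; linarith
    have c5 : 2 * (n : ℝ) + 2 * lam + 1 ≠ 0 := by apply ne_of_gt; linarith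
    have hA := aux_psi_succ (show 0 < (n : ℝ) + lam + 1 by linarith)
    have hB := aux_psi_succ (show 0 < (n : ℝ) + lam + 1 / 2 by linarith)
    have hC := aux_psi_succ (show 0 < 2 * (n : ℝ) + 2 * lam + 1 by linarith)
    have hD := aux_psi_succ (show 0 < 2 * (n : ℝ) + 2 * lam + 1 + 1 by linarith)
    have hE := aux_psi_succ (show 0 < (n : ℝ) + 2 * lam + 1 by linarith)
    have hB' : 1 / ((n : ℝ) + lam + 1 / 2) = 2 / (2 * n + 2 * lam + 1) := by
      rw [div_eq_div_iff (by apply ne_of_gt; linarith) c5]; ring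
    have hD' : 1 / (2 * (n : ℝ) + 2 * lam + 1 + 1) = (1 / 2) * (1 / (n + lam + 1)) := by
      rw [show 2 * (n : ℝ) + 2 * lam + 1 + 1 = 2 * (n + lam + 1) by ring]; field_simp
    push_cast
    rw [show (n : ℝ) + 1 + lam + 1 = n + lam + 1 + 1 by ring,
      show (n : ℝ) + 1 + lam + 1 / 2 = n + lam + 1 / 2 + 1 by ring,
      show 2 * ((n : ℝ) + 1) + 2 * lam + 1 = 2 * n + 2 * lam + 1 + 1 + 1 by ring,
      show (n : ℝ) + 1 + 2 * lam + 1 = n + 2 * lam + 1 + 1 by ring, hA, hB, hD, hC, hE, hB', hD',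
      show (n : ℝ) + 1 + lam = n + lam + 1 by ring,
      show (n : ℝ) + 1 + 2 * lam = n + 2 * lam + 1 by ring]
    have z1 : ((n : ℝ) + lam + 1) * (1 / (n + lam + 1)) = 1 := mul_one_div_cancel c3
    have z2 : ((n : ℝ) + 2 * lam + 1) * (1 / (n + 2 * lam + 1)) = 1 := mul_one_div_cancel c4
    rw [show (2 : ℝ) / (n + 2 * lam + 1) = 2 * (1 / (n + 2 * lam + 1)) by ring,
      show (2 : ℝ) / (2 * n + 2 * lam + 1) = 2 * (1 / (2 * n + 2 * lam + 1)) by ring]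
    generalize 1 / ((n : ℝ) + lam + 1) = u at *
    generalize 1 / ((n : ℝ) + 2 * lam + 1) = v at *
    generalize 1 / (2 * (n : ℝ) + 2 * lam + 1) = t at *
    linear_combination (-2) * z1 + 2 * z2
end

section
/- For every integer n ≥ 1: Σ_{k=0}^{n} ∫_{-1}^{1} Ĉ_k(x)² · w(x) · log( 1/√(2-2x) ) dx = H_n / 4, where Ĉ_k are the normalized Chebyshev polynomials and w(x) = 1/(π√(1-x²)). -/
open Real MeasureTheory Finset

/-- Normalized Chebyshev polynomials of the first kind:
`Ĉ_0 = 1`, `Ĉ_j = √2 · T_j` for `j ≥ 1`. -/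
noncomputable def Chat (j : ℕ) (x : ℝ) : ℝ :=
  if j = 0 then 1 else Real.sqrt 2 * (Polynomial.Chebyshev.T ℝ (j : ℤ)).eval x

/-- The Chebyshev weight `w(x) = 1/(π√(1-x²))`. -/
noncomputable def w0 (x : ℝ) : ℝ := 1 / (Real.pi * Real.sqrt (1 - x ^ 2))

/-- The `n`-th harmonic number. -/
noncomputable def H (n : ℕ) : ℝ := ∑ k ∈ Finset.Icc 1 n, 1 / (k : ℝ)

lemma aux_dir (m : ℕ) (x : ℝ) :
    (∑ j ∈ Finset.range m, (cos (2 * j * x) + cos (2 * (j + 1) * x))) * sin x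
      = sin (2 * m * x) * cos x := by
  induction m with
  | zero => simp
  | succ m ih =>
    rw [Finset.sum_range_succ, add_mul, ih]
    have h1 : 2 * (m : ℝ) * x = (2 * m + 1) * x - x := by ring
    have h2 : 2 * ((m : ℝ) + 1) * x = (2 * m + 1) * x + x := by ring
    push_cast
    rw [h1, h2, cos_sub, cos_add, sin_sub, sin_add]
    ring

lemma aux_cos (j : ℕ) (hj : j ≠ 0) : ∫ x in (0:ℝ)..(π / 2), cos (2 * j * x) = 0 := by
  have hj' : (2 * (j : ℝ)) ≠ 0 := by positivity
  rw [intervalIntegral.integral_comp_mul_left (fun x => cos x) hj', integral_cos]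
  have : 2 * (j : ℝ) * (π / 2) = j * π := by ring
  rw [this, sin_nat_mul_pi]
  simp

lemma aux_dir_int (m : ℕ) :
    ∫ x in (0:ℝ)..(π / 2), (∑ j ∈ Finset.range (m + 1),
      (cos (2 * j * x) + cos (2 * (j + 1) * x))) = π / 2 := by
  rw [intervalIntegral.integral_finsetSum
    (fun i _ => Continuous.intervalIntegrable (by fun_prop) _ _)]
  have key : ∀ j : ℕ, ∫ x in (0:ℝ)..(π / 2), (cos (2 * j * x) + cos (2 * (j + 1) * x))
      = if j = 0 then π / 2 else 0 := by
    intro j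
    rw [intervalIntegral.integral_add (Continuous.intervalIntegrable (by fun_prop) _ _)
      (Continuous.intervalIntegrable (by fun_prop) _ _)]
    have h := aux_cos (j + 1) (by omega)
    push_cast at h
    rw [h]
    split_ifs with hj
    · subst hj; simp
    · rw [aux_cos j hj]; simp
  simp_rw [key]
  simp

lemma aux_int (m : ℕ) (f : ℝ → ℝ) (hf : Continuous f) (a b : ℝ) :
    IntervalIntegrable (fun x => f x * log (sin x)) volume a b :=
  (intervalIntegrable_log_sin (a := a) (b := b)).continuousOn_mul hf.continuousOn

lemma aux_J (m : ℕ) :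
    ∫ x in (0:ℝ)..(π / 2), cos (2 * ((m + 1 : ℕ) : ℝ) * x) * log (sin x)
      = - (π / (4 * ((m + 1 : ℕ) : ℝ))) := by
  set M : ℝ := ((m + 1 : ℕ) : ℝ) with hM
  have hM0 : M ≠ 0 := by rw [hM]; positivity
  set D : ℝ → ℝ := fun x => ∑ j ∈ Finset.range (m + 1),
      (cos (2 * j * x) + cos (2 * (j + 1) * x)) with hD
  have hDc : Continuous D := by rw [hD]; fun_prop
  set F : ℝ → ℝ := fun x => sin (2 * M * x) * log (sin x) with hF
  have hFeq : F = fun x => (Polynomial.Chebyshev.U ℝ (2 * m + 1 : ℤ)).eval (cos x)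
      * (sin x * log (sin x)) := by
    funext x
    have h := Polynomial.Chebyshev.U_real_cos x (2 * m + 1 : ℤ)
    have h2 : (((2 * m + 1 : ℤ) : ℝ) + 1) * x = 2 * M * x := by
      rw [hM]; push_cast; ring
    rw [h2] at h
    rw [hF]
    simp only
    rw [← h]; ring
  have hFc : Continuous F := by
    rw [hFeq]
    exact ((Polynomial.Chebyshev.U ℝ (2 * m + 1 : ℤ)).continuous.comp continuous_cos).mul
      (continuous_mul_log.comp continuous_sin)
  have hi1 := aux_int m (fun x => 2 * M * cos (2 * M * x)) (by fun_prop) 0 (π / 2)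
  have hi2 : IntervalIntegrable D volume 0 (π / 2) := hDc.intervalIntegrable _ _
  have hd : ∀ x ∈ Set.Ioo (0:ℝ) (π / 2),
      HasDerivAt F (2 * M * cos (2 * M * x) * log (sin x) + D x) x := by
    intro x hx
    have hs : 0 < sin x := sin_pos_of_pos_of_lt_pi hx.1 (by linarith [hx.2, pi_pos])
    have h1 : HasDerivAt (fun x => sin (2 * M * x)) (cos (2 * M * x) * (2 * M)) x := by
      have := ((hasDerivAt_id x).const_mul (2 * M)).sin
      simpa using this
    have h2 := h1.mul ((hasDerivAt_sin x).log hs.ne')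
    convert! h2 using 1
    have h3 := aux_dir (m + 1) x
    rw [← hM] at h3
    have h4 : D x = sin (2 * M * x) * (cos x / sin x) := by
      rw [← mul_div_assoc, eq_div_iff hs.ne']; exact h3
    rw [h4]; ring
  have := intervalIntegral.integral_eq_sub_of_hasDerivAt_of_le (by positivity)
    hFc.continuousOn hd (hi1.add hi2)
  rw [intervalIntegral.integral_add hi1 hi2, hD, aux_dir_int] at this
  simp only [hF, sin_pi_div_two, log_one, mul_zero, sin_zero, log_zero, sub_zero] at this
  simp_rw [mul_assoc (2 * M)] at this
  rw [intervalIntegral.integral_const_mul] at this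
  field_simp
  linarith

lemma aux_J0 (k : ℕ) :
    ∫ x in (0:ℝ)..(π / 2), (1 + cos (2 * ((2 * (k + 1) : ℕ) : ℝ) * x)) * (-(log 2 + log (sin x)))
      = π / (8 * ((k + 1 : ℕ) : ℝ)) := by
  have h1 := aux_J (2 * k + 1)
  have e : 2 * k + 1 + 1 = 2 * (k + 1) := by ring
  rw [e] at h1
  have h2 := aux_cos (2 * (k + 1)) (by omega)
  have h3 := integral_log_sin_zero_pi_div_two
  set M : ℝ := ((2 * (k + 1) : ℕ) : ℝ) with hM
  have hM' : M = 2 * ((k + 1 : ℕ) : ℝ) := by rw [hM]; push_cast; ring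
  have i1 : IntervalIntegrable (fun x => (-log 2) * (1 + cos (2 * M * x))) volume 0 (π / 2) :=
    Continuous.intervalIntegrable (by fun_prop) _ _
  have i2 : IntervalIntegrable (fun x => log (sin x)) volume 0 (π / 2) :=
    intervalIntegrable_log_sin
  have i3 := aux_int 0 (fun x => cos (2 * M * x)) (by fun_prop) 0 (π / 2)
  have : ∀ x, (1 + cos (2 * M * x)) * (-(log 2 + log (sin x))) =
    (-log 2) * (1 + cos (2 * M * x)) - log (sin x) - cos (2 * M * x) * log (sin x) := by
    intro x; ring
  simp_rw [this]
  rw [intervalIntegral.integral_sub (i1.sub i2) i3, intervalIntegral.integral_sub i1 i2, h1, h3,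
    intervalIntegral.integral_const_mul,
    intervalIntegral.integral_add (by simp) (Continuous.intervalIntegrable (by fun_prop) _ _), h2,
    hM']
  simp only [intervalIntegral.integral_const, smul_eq_mul]
  have : ((k + 1 : ℕ) : ℝ) ≠ 0 := by positivity
  field_simp
  ring

lemma aux_log (t : ℝ) (ht : t ∈ Set.Ioc 0 π) :
    log (1 / √(2 - 2 * cos t)) = -(log 2 + log (sin (t / 2))) := by
  have hs : 0 < sin (t / 2) := sin_pos_of_pos_of_lt_pi (by linarith [ht.1])
    (by linarith [ht.2, pi_pos])
  have : 2 - 2 * cos t = (2 * sin (t / 2)) ^ 2 := by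
    have h := cos_two_mul (t / 2)
    have h' := sin_sq_add_cos_sq (t / 2)
    rw [mul_div_cancel₀ _ two_ne_zero] at h
    rw [h]; linarith
  rw [this, sqrt_sq (by positivity), one_div, log_inv, log_mul two_ne_zero hs.ne']

lemma aux_sub (g h : ℝ → ℝ)
    (hg : ∀ t ∈ Set.Ioc (0:ℝ) π, g (cos t) = h (t / 2)) :
    ∫ x in Set.Icc (-1 : ℝ) 1, g x * w0 x * log (1 / √(2 - 2 * x))
      = 2 / π * ∫ x in (0:ℝ)..(π / 2), h x * (-(log 2 + log (sin x))) := by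
  have e1 : ∫ x in Set.Icc (-1 : ℝ) 1, g x * w0 x * log (1 / √(2 - 2 * x))
      = ∫ x in (-1:ℝ)..1, (1 / π * (g x * log (1 / √(2 - 2 * x)))) * √(1 - x ^ 2)⁻¹ := by
    rw [intervalIntegral.integral_of_le (by norm_num), integral_Icc_eq_integral_Ioc]
    congr 1
    funext x
    simp only [w0, one_div, mul_inv, sqrt_inv]
    ring
  rw [e1, ← Polynomial.Chebyshev.integral_measureT
    (fun x => 1 / π * (g x * log (1 / √(2 - 2 * x)))),
    Polynomial.Chebyshev.integral_measureT_eq_integral_cos, intervalIntegral.integral_const_mul]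
  have e2 : ∫ t in (0:ℝ)..π, g (cos t) * log (1 / √(2 - 2 * cos t))
      = ∫ t in (0:ℝ)..π, (fun x => h x * (-(log 2 + log (sin x)))) (t / 2) := by
    apply intervalIntegral.integral_congr_ae
    refine Filter.Eventually.of_forall fun t ht => ?_
    rw [Set.uIoc_of_le pi_pos.le] at ht
    simp only
    rw [hg t ht, aux_log t ht]
  rw [e2, intervalIntegral.integral_comp_div (fun x => h x * (-(log 2 + log (sin x)))) two_ne_zero]
  simp only [zero_div, smul_eq_mul]
  ring

lemma aux_term (k : ℕ) :
    ∫ x in Set.Icc (-1 : ℝ) 1, Chat (k + 1) x ^ 2 * w0 x * log (1 / √(2 - 2 * x))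
      = 1 / ((k + 1 : ℕ) : ℝ) / 4 := by
  rw [aux_sub (fun x => Chat (k + 1) x ^ 2)
    (fun x => 1 + cos (2 * ((2 * (k + 1) : ℕ) : ℝ) * x)), aux_J0]
  · have : ((k + 1 : ℕ) : ℝ) ≠ 0 := by positivity
    field_simp
    norm_num
  · intro t _
    simp only [Chat, Nat.succ_ne_zero, if_false]
    rw [Polynomial.Chebyshev.T_real_cos, mul_pow, sq_sqrt (by norm_num), cos_sq]
    push_cast
    have : 2 * (2 * ((k : ℝ) + 1)) * (t / 2) = 2 * (((k : ℝ) + 1) * t) := by ring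
    rw [this]; ring

lemma aux_zero :
    ∫ x in Set.Icc (-1 : ℝ) 1, Chat 0 x ^ 2 * w0 x * log (1 / √(2 - 2 * x)) = 0 := by
  rw [aux_sub (fun x => Chat 0 x ^ 2) (fun _ => 1) (by intro t _; simp [Chat])]
  have i2 : IntervalIntegrable (fun x => log (sin x)) volume 0 (π / 2) :=
    intervalIntegrable_log_sin
  simp only [one_mul]
  rw [intervalIntegral.integral_neg, intervalIntegral.integral_add (by simp) i2,
    integral_log_sin_zero_pi_div_two]
  simp only [intervalIntegral.integral_const, smul_eq_mul]
  ring

theorem chebyshev_log_sum (n : ℕ) (hn : 1 ≤ n) :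
    (∑ k ∈ Finset.range (n + 1),
      ∫ x in Set.Icc (-1 : ℝ) 1,
        Chat k x ^ 2 * w0 x * Real.log (1 / Real.sqrt (2 - 2 * x))) =
      H n / 4 := by
  rw [Finset.sum_range_succ', aux_zero, add_zero]
  simp_rw [aux_term]
  rw [← Finset.sum_div, H, Finset.range_eq_Ico, Finset.sum_Ico_add' (fun k : ℕ => 1 / (k : ℝ)) 0 n 1]
  rfl
end

section
/- Let λ ∈ (-1/2,0) ∪ (0,∞) and let k ≥ 0 be an integer. Then ∫_{-1}^{1} Ĉ_k^λ(x)² · w^λ(x) · log(1-x) dx = -2·ψ(2λ+2k) + ψ(2λ+k) + log 2 + ψ(λ+k+1/2) - 1/(2k+2λ), where ψ is the digamma function. Equivalently, ∫_{-1}^{1} C_k^λ(x)² (1-x²)^{λ-1/2} log(1-x) dx = [ π·2^{1-2λ}·Γ(2λ+k) / ( k!·(k+λ)·Γ(λ)² ) ] · ( -2·ψ(2λ+2k) + ψ(2λ+k) + log 2 + ψ(λ+k+1/2) - 1/(2k+2λ) ). -/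
open Real MeasureTheory Finset

noncomputable def betaAux (b : ℝ) (t : ℝ) : ℂ :=
  Set.indicator (Set.Ioo 0 1) (fun t : ℝ => (((1 - t) ^ (b - 1) : ℝ) : ℂ)) t

lemma betaAux_integrable (b : ℝ) (hb : 0 < b) : Integrable (betaAux b) := by
  unfold betaAux
  rw [integrable_indicator_iff measurableSet_Ioo]
  have h : IntervalIntegrable (fun t : ℝ => t ^ (b - 1)) volume 0 1 :=
    intervalIntegral.intervalIntegrable_rpow' (by linarith)
  have h2 := (h.comp_sub_left 1).symm
  simp only [sub_zero, sub_self] at h2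
  rw [intervalIntegrable_iff_integrableOn_Ioo_of_le zero_le_one] at h2
  exact h2.ofReal

lemma mellin_betaAux (b : ℝ) (z : ℂ) : mellin (betaAux b) z = Complex.betaIntegral z b := by
  unfold mellin Complex.betaIntegral betaAux
  rw [intervalIntegral.integral_of_le zero_le_one, integral_Ioc_eq_integral_Ioo]
  have : ∀ t : ℝ, (t : ℂ) ^ (z - 1) • Set.indicator (Set.Ioo 0 1)
      (fun t : ℝ => (((1 - t) ^ (b - 1) : ℝ) : ℂ)) t =
      Set.indicator (Set.Ioo 0 1)
      (fun t : ℝ => (t : ℂ) ^ (z - 1) * (1 - (t : ℂ)) ^ ((b : ℂ) - 1)) t := by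
    intro t
    by_cases ht : t ∈ Set.Ioo (0 : ℝ) 1
    · rw [Set.indicator_of_mem ht, Set.indicator_of_mem ht, smul_eq_mul,
        Complex.ofReal_cpow (by linarith [ht.2])]
      push_cast
      rfl
    · rw [Set.indicator_of_notMem ht, Set.indicator_of_notMem ht, smul_zero]
  simp_rw [this]
  rw [setIntegral_indicator measurableSet_Ioo]
  congr 2
  ext t
  simp +contextual

lemma betaAux_deriv (a b : ℝ) (ha : 0 < a) (hb : 0 < b) :
    MellinConvergent (fun t => Real.log t • betaAux b t) a ∧
      HasDerivAt (mellin (betaAux b)) (mellin (fun t => Real.log t • betaAux b t) a) a := by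
  refine mellin_hasDerivAt_of_isBigO_rpow (a := a + 1) (b := 0)
    ((betaAux_integrable b hb).locallyIntegrable.locallyIntegrableOn _) ?_ (by simp) ?_
    (by simpa using ha)
  · have : betaAux b =ᶠ[Filter.atTop] 0 := by
      filter_upwards [Filter.eventually_ge_atTop 1] with t ht
      unfold betaAux
      rw [Set.indicator_of_notMem (fun h => by linarith [h.2])]
      rfl
    exact this.trans_isBigO (Asymptotics.isBigO_zero _ _)
  · simp only [neg_zero, Real.rpow_zero]
    have h1 : betaAux b =ᶠ[nhdsWithin 0 (Set.Ioi 0)]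
        (fun t : ℝ => (((1 - t) ^ (b - 1) : ℝ) : ℂ)) := by
      filter_upwards [Ioo_mem_nhdsGT (zero_lt_one (α := ℝ))] with t ht
      unfold betaAux
      rw [Set.indicator_of_mem ht]
    refine h1.trans_isBigO ?_
    have h2 : ContinuousAt (fun t : ℝ => (((1 - t) ^ (b - 1) : ℝ) : ℂ)) 0 := by
      apply Complex.continuous_ofReal.continuousAt.comp
      apply ContinuousAt.rpow_const (by fun_prop)
      left; norm_num
    exact (h2.tendsto.isBigO_one ℝ).mono nhdsWithin_le_nhds

lemma beta_int (a b : ℝ) (ha : 0 < a) (hb : 0 < b) :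
    IntegrableOn (fun t : ℝ => t ^ (a - 1) * (1 - t) ^ (b - 1)) (Set.Ioo 0 1) ∧
    ∫ t in Set.Ioo (0 : ℝ) 1, t ^ (a - 1) * (1 - t) ^ (b - 1) =
      Gamma a * Gamma b / Gamma (a + b) := by
  have h := Complex.betaIntegral_convergent (u := a) (v := b) (by simpa) (by simpa)
  rw [intervalIntegrable_iff_integrableOn_Ioo_of_le zero_le_one] at h
  have heq : Set.EqOn (fun t : ℝ => (t : ℂ) ^ ((a : ℂ) - 1) * (1 - (t : ℂ)) ^ ((b : ℂ) - 1))
      (fun t : ℝ => ((t ^ (a - 1) * (1 - t) ^ (b - 1) : ℝ) : ℂ)) (Set.Ioo 0 1) := by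
    intro t ht
    simp only
    rw [Complex.ofReal_mul, Complex.ofReal_cpow ht.1.le, Complex.ofReal_cpow (by linarith [ht.2])]
    push_cast
    rfl
  constructor
  · have h3 := (h.congr_fun heq measurableSet_Ioo).re
    simpa using! h3
  · have h4 := Complex.betaIntegral_eq_Gamma_mul_div (a : ℂ) b (by simpa) (by simpa)
    unfold Complex.betaIntegral at h4
    rw [intervalIntegral.integral_of_le zero_le_one, integral_Ioc_eq_integral_Ioo,
      setIntegral_congr_fun measurableSet_Ioo heq, integral_complex_ofReal, ← Complex.ofReal_add,
      Complex.Gamma_ofReal, Complex.Gamma_ofReal, Complex.Gamma_ofReal] at h4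
    exact_mod_cast h4

lemma beta_log_int (a b : ℝ) (ha : 0 < a) (hb : 0 < b) :
    IntegrableOn (fun t : ℝ => t ^ (a - 1) * (1 - t) ^ (b - 1) * Real.log t) (Set.Ioo 0 1) ∧
    ∫ t in Set.Ioo (0 : ℝ) 1, t ^ (a - 1) * (1 - t) ^ (b - 1) * Real.log t =
      Gamma a * Gamma b / Gamma (a + b) * (psi a - psi (a + b)) := by
  obtain ⟨h1, h2⟩ := betaAux_deriv a b ha hb
  have key : ∀ t ∈ Set.Ioi (0 : ℝ), (t : ℂ) ^ ((a : ℂ) - 1) • (Real.log t • betaAux b t) =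
      Set.indicator (Set.Ioo 0 1)
      (fun t : ℝ => ((t ^ (a - 1) * (1 - t) ^ (b - 1) * Real.log t : ℝ) : ℂ)) t := by
    intro t ht0
    unfold betaAux
    by_cases ht : t ∈ Set.Ioo (0 : ℝ) 1
    · rw [Set.indicator_of_mem ht, Set.indicator_of_mem ht, smul_eq_mul, Complex.ofReal_mul,
        Complex.ofReal_mul, Complex.ofReal_cpow ht.1.le, Complex.real_smul]
      push_cast
      ring
    · rw [Set.indicator_of_notMem ht, Set.indicator_of_notMem ht, smul_zero, smul_zero]
  have hset : Set.Ioi (0 : ℝ) ∩ Set.Ioo 0 1 = Set.Ioo 0 1 := by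
    ext t
    simp +contextual
  have h3 : IntegrableOn (Set.indicator (Set.Ioo 0 1)
      (fun t : ℝ => ((t ^ (a - 1) * (1 - t) ^ (b - 1) * Real.log t : ℝ) : ℂ))) (Set.Ioi 0) :=
    IntegrableOn.congr_fun h1 key measurableSet_Ioi
  constructor
  · rw [IntegrableOn, integrable_indicator_iff measurableSet_Ioo, IntegrableOn,
      Measure.restrict_restrict measurableSet_Ioo, Set.inter_comm, hset] at h3
    simpa using! h3.re
  · have h4 : mellin (fun t => Real.log t • betaAux b t) a =
        ((∫ t in Set.Ioo (0 : ℝ) 1, t ^ (a - 1) * (1 - t) ^ (b - 1) * Real.log t : ℝ) : ℂ) := by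
      unfold mellin
      rw [setIntegral_congr_fun measurableSet_Ioi key, setIntegral_indicator measurableSet_Ioo,
        hset, integral_complex_ofReal]
    have h5 := h2.real_of_complex
    rw [h4, Complex.ofReal_re] at h5
    have h6 : (fun x : ℝ => (mellin (betaAux b) x).re) =ᶠ[nhds a]
        fun x => Gamma x * Gamma b / Gamma (x + b) := by
      filter_upwards [lt_mem_nhds ha] with x hx
      rw [mellin_betaAux, Complex.betaIntegral_eq_Gamma_mul_div (x : ℂ) b (by simpa) (by simpa),
        ← Complex.ofReal_add, Complex.Gamma_ofReal, Complex.Gamma_ofReal, Complex.Gamma_ofReal]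
      norm_cast
    have h7 := h5.congr_of_eventuallyEq h6.symm
    have hG : ∀ x : ℝ, 0 < x → HasDerivAt Gamma (deriv Gamma x) x := fun x hx =>
      (Real.differentiableAt_Gamma (fun m => by
        have : (0 : ℝ) ≤ m := by positivity
        linarith)).hasDerivAt
    have ha' := (Gamma_pos_of_pos ha).ne'
    have hab' := (Gamma_pos_of_pos (add_pos ha hb)).ne'
    have h8 := ((hG a ha).mul_const (Gamma b)).div ((hG (a + b) (by linarith)).comp_add_const a b) hab'
    rw [h7.unique h8]
    unfold psi
    field_simp

lemma psi_add_one (x : ℝ) (hx : ∀ m : ℕ, x ≠ -m) : psi (x + 1) = psi x + 1 / x := by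
  have hx0 : x ≠ 0 := by simpa using hx 0
  have hd := Real.differentiableAt_Gamma hx
  have hx1 : ∀ m : ℕ, x + 1 ≠ -m := fun m h => hx (m + 1) (by push_cast; linarith)
  have hd1 := Real.differentiableAt_Gamma hx1
  have h1 : HasDerivAt (fun y => Gamma (y + 1)) (deriv Gamma (x + 1)) x :=
    hd1.hasDerivAt.comp_add_const x 1
  have h2 : HasDerivAt (fun y => y * Gamma y) (1 * Gamma x + x * deriv Gamma x) x :=
    (hasDerivAt_id' x).mul hd.hasDerivAt
  have h3 : (fun y => Gamma (y + 1)) =ᶠ[nhds x] (fun y => y * Gamma y) := by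
    filter_upwards [isOpen_ne.mem_nhds hx0] with y hy using Gamma_add_one hy
  have h4 := h1.unique (h2.congr_of_eventuallyEq h3)
  have := Gamma_ne_zero hx
  unfold psi
  rw [h4, Gamma_add_one hx0]
  field_simp
  ring

lemma w_base (l : ℝ) (hl : -(1 / 2) < l) :
    IntervalIntegrable (fun x : ℝ => (1 - x ^ 2) ^ (l - 1 / 2)) volume (-1) 1 ∧
    IntervalIntegrable (fun x : ℝ => (1 - x ^ 2) ^ (l - 1 / 2) * Real.log (1 - x)) volume (-1) 1 ∧
    (∫ x in (-1 : ℝ)..1, (1 - x ^ 2) ^ (l - 1 / 2)) =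
      2 ^ (2 * l) * (Gamma (l + 1 / 2) * Gamma (l + 1 / 2) / Gamma (2 * l + 1)) ∧
    (∫ x in (-1 : ℝ)..1, (1 - x ^ 2) ^ (l - 1 / 2) * Real.log (1 - x)) =
      2 ^ (2 * l) * (Gamma (l + 1 / 2) * Gamma (l + 1 / 2) / Gamma (2 * l + 1)) *
        (psi (l + 1 / 2) - psi (2 * l + 1) + Real.log 2) := by
  have ha : 0 < l + 1 / 2 := by linarith
  obtain ⟨i1, e1⟩ := beta_int (l + 1 / 2) (l + 1 / 2) ha ha
  obtain ⟨i2, e2⟩ := beta_log_int (l + 1 / 2) (l + 1 / 2) ha ha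
  rw [show l + 1 / 2 - 1 = l - 1 / 2 by ring] at i1 i2 e1 e2
  rw [show l + 1 / 2 + (l + 1 / 2) = 2 * l + 1 by ring] at e1 e2
  rw [← intervalIntegrable_iff_integrableOn_Ioo_of_le zero_le_one] at i1 i2
  rw [← integral_Ioc_eq_integral_Ioo, ← intervalIntegral.integral_of_le zero_le_one] at e1 e2
  have trI : ∀ f : ℝ → ℝ, IntervalIntegrable f volume 0 1 →
      IntervalIntegrable (fun x => f (1 / 2 - x / 2)) volume (-1) 1 := by
    intro f hf
    have := ((hf.comp_sub_left (1 / 2)).comp_mul_left (c := 1 / 2)).symm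
    norm_num at this
    convert! this using 3
    ring
  have trE : ∀ f : ℝ → ℝ, ∫ x in (-1 : ℝ)..1, f (1 / 2 - x / 2) = 2 * ∫ x in (0 : ℝ)..1, f x := by
    intro f
    rw [intervalIntegral.integral_comp_sub_div f two_ne_zero]
    norm_num
  have hw : ∀ x ∈ Set.Ioo (-1 : ℝ) 1, (1 - x ^ 2) ^ (l - 1 / 2) = (4 : ℝ) ^ (l - 1 / 2) *
      ((1 / 2 - x / 2) ^ (l - 1 / 2) * (1 - (1 / 2 - x / 2)) ^ (l - 1 / 2)) := by
    intro x hx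
    have h1 : 0 ≤ 1 / 2 - x / 2 := by linarith [hx.2]
    have h2 : 0 ≤ 1 - (1 / 2 - x / 2) := by linarith [hx.1]
    rw [← mul_rpow h1 h2, ← mul_rpow (by norm_num) (mul_nonneg h1 h2)]
    congr 1
    ring
  have hwl : ∀ x ∈ Set.Ioo (-1 : ℝ) 1, (1 - x ^ 2) ^ (l - 1 / 2) * Real.log (1 - x) =
      (4 : ℝ) ^ (l - 1 / 2) *
      ((1 / 2 - x / 2) ^ (l - 1 / 2) * (1 - (1 / 2 - x / 2)) ^ (l - 1 / 2) *
          Real.log (1 / 2 - x / 2) + Real.log 2 * (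
        (1 / 2 - x / 2) ^ (l - 1 / 2) * (1 - (1 / 2 - x / 2)) ^ (l - 1 / 2))) := by
    intro x hx
    rw [hw x hx, show 1 - x = 2 * (1 / 2 - x / 2) by ring,
      Real.log_mul two_ne_zero (by linarith [hx.2])]
    ring
  have h4 : (4 : ℝ) ^ (l - 1 / 2) * 2 = 2 ^ (2 * l) := by
    rw [show (4 : ℝ) = 2 ^ (2 : ℝ) by norm_num, ← rpow_mul (by norm_num)]
    rw [← rpow_add_one (by norm_num)]
    congr 1
    ring
  have hle : (-1 : ℝ) ≤ 1 := by norm_num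
  have toI : ∀ f g : ℝ → ℝ, Set.EqOn f g (Set.Ioo (-1 : ℝ) 1) →
      ∫ x in (-1 : ℝ)..1, f x = ∫ x in (-1 : ℝ)..1, g x := by
    intro f g h
    rw [intervalIntegral.integral_of_le hle, intervalIntegral.integral_of_le hle,
      integral_Ioc_eq_integral_Ioo, integral_Ioc_eq_integral_Ioo]
    exact setIntegral_congr_fun measurableSet_Ioo h
  have toC : ∀ f g : ℝ → ℝ, Set.EqOn f g (Set.Ioo (-1 : ℝ) 1) →
      IntervalIntegrable g volume (-1) 1 → IntervalIntegrable f volume (-1) 1 := by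
    intro f g h hg
    rw [intervalIntegrable_iff_integrableOn_Ioo_of_le hle] at hg ⊢
    exact hg.congr_fun h.symm measurableSet_Ioo
  have j1 := trI _ i1
  have j2 := trI _ i2
  refine ⟨toC _ _ hw (j1.const_mul _), toC _ _ hwl ((j2.add (j1.const_mul _)).const_mul _), ?_, ?_⟩
  · rw [toI _ _ hw, intervalIntegral.integral_const_mul,
      trE (fun t => t ^ (l - 1 / 2) * (1 - t) ^ (l - 1 / 2)), e1, ← h4]
    ring
  · rw [toI _ _ hwl, intervalIntegral.integral_const_mul,
      trE (fun t => t ^ (l - 1 / 2) * (1 - t) ^ (l - 1 / 2) * Real.log t + Real.log 2 *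
        (t ^ (l - 1 / 2) * (1 - t) ^ (l - 1 / 2))), intervalIntegral.integral_add i2
        (i1.const_mul _), intervalIntegral.integral_const_mul, e1, e2, ← h4]
    ring

open Polynomial in
lemma intW (l : ℝ) (hl : -(1 / 2) < l) (p : ℝ[X]) :
    IntervalIntegrable (fun x : ℝ => p.eval x * (1 - x ^ 2) ^ (l - 1 / 2)) volume (-1) 1 :=
  (w_base l hl).1.continuousOn_mul p.continuous.continuousOn

open Polynomial in
lemma intWL (l : ℝ) (hl : -(1 / 2) < l) (p : ℝ[X]) :
    IntervalIntegrable (fun x : ℝ => p.eval x * ((1 - x ^ 2) ^ (l - 1 / 2) * Real.log (1 - x)))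
      volume (-1) 1 :=
  (w_base l hl).2.1.continuousOn_mul p.continuous.continuousOn

open Polynomial in
/-- Integration of a polynomial against the weight. -/
noncomputable def MW (l : ℝ) (hl : -(1 / 2) < l) : ℝ[X] →ₗ[ℝ] ℝ where
  toFun p := ∫ x in (-1 : ℝ)..1, p.eval x * (1 - x ^ 2) ^ (l - 1 / 2)
  map_add' p q := by
    rw [← intervalIntegral.integral_add (intW l hl p) (intW l hl q)]
    simp only [eval_add, add_mul]
  map_smul' c p := by
    simp only [eval_smul, smul_eq_mul, mul_assoc, intervalIntegral.integral_const_mul,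
      RingHom.id_apply]

open Polynomial in
/-- Integration of a polynomial against the weight times `log (1 - x)`. -/
noncomputable def LW (l : ℝ) (hl : -(1 / 2) < l) : ℝ[X] →ₗ[ℝ] ℝ where
  toFun p := ∫ x in (-1 : ℝ)..1, p.eval x * ((1 - x ^ 2) ^ (l - 1 / 2) * Real.log (1 - x))
  map_add' p q := by
    rw [← intervalIntegral.integral_add (intWL l hl p) (intWL l hl q)]
    simp only [eval_add, add_mul]
  map_smul' c p := by
    simp only [eval_smul, smul_eq_mul, mul_assoc, intervalIntegral.integral_const_mul,
      RingHom.id_apply]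

open Polynomial in
/-- `D Q = (1 - X²) Q' - (2λ+1) X Q`. -/
noncomputable def DW (l : ℝ) (Q : ℝ[X]) : ℝ[X] :=
  (1 - X ^ 2) * derivative Q - C (2 * l + 1) * (X * Q)

open Polynomial in
lemma DW_deriv (l : ℝ) (Q : ℝ[X]) (x : ℝ) (hx : x ∈ Set.Ioo (-1 : ℝ) 1) :
    HasDerivAt (fun x : ℝ => (1 - x ^ 2) ^ (l + 1 / 2) * Q.eval x)
      ((DW l Q).eval x * (1 - x ^ 2) ^ (l - 1 / 2)) x := by
  have hp : 0 < 1 - x ^ 2 := by nlinarith [hx.1, hx.2]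
  have h1 : HasDerivAt (fun x : ℝ => 1 - x ^ 2) (-(2 * x)) x := by
    simpa using ((hasDerivAt_id' x).pow 2).const_sub 1
  have h2 := (h1.rpow_const (p := l + 1 / 2) (Or.inl hp.ne')).mul (Q.hasDerivAt x)
  convert! h2 using 1
  rw [show l + 1 / 2 - 1 = l - 1 / 2 by ring, show l + 1 / 2 = (l - 1 / 2) + 1 by ring,
    rpow_add_one hp.ne']
  simp only [DW, eval_sub, eval_mul, eval_one, eval_pow, eval_X, eval_C]
  ring

open Polynomial in
lemma MW_DW (l : ℝ) (hl : -(1 / 2) < l) (Q : ℝ[X]) : MW l hl (DW l Q) = 0 := by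
  have h := intervalIntegral.integral_eq_sub_of_hasDerivAt_of_le (a := (-1 : ℝ)) (b := 1)
    (by norm_num) (f := fun x : ℝ => (1 - x ^ 2) ^ (l + 1 / 2) * Q.eval x) ?_ (DW_deriv l Q)
    (intW l hl _)
  · change (∫ x in (-1 : ℝ)..1, (DW l Q).eval x * (1 - x ^ 2) ^ (l - 1 / 2)) = 0
    rw [h]
    have : l + 1 / 2 ≠ 0 := by linarith
    norm_num [zero_rpow this]
  · apply ContinuousOn.mul _ Q.continuous.continuousOn
    apply ContinuousOn.rpow_const (by fun_prop)
    intro x _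
    right; linarith

open Polynomial in
lemma LW_DW (l : ℝ) (hl : -(1 / 2) < l) (Q : ℝ[X]) :
    LW l hl (DW l Q) = MW l hl ((1 + X) * Q) := by
  have ha : 0 < l + 1 / 2 := by linarith
  have hd : ∀ x ∈ Set.Ioo (-1 : ℝ) 1,
      HasDerivAt (fun x : ℝ => (1 - x ^ 2) ^ (l + 1 / 2) * Q.eval x * Real.log (1 - x))
      ((DW l Q).eval x * ((1 - x ^ 2) ^ (l - 1 / 2) * Real.log (1 - x)) -
        ((1 + X) * Q).eval x * (1 - x ^ 2) ^ (l - 1 / 2)) x := by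
    intro x hx
    have hp : 0 < 1 - x ^ 2 := by nlinarith [hx.1, hx.2]
    have hx1 : 1 - x ≠ 0 := by linarith [hx.2]
    have h1 : HasDerivAt (fun x : ℝ => Real.log (1 - x)) (-1 / (1 - x)) x :=
      ((hasDerivAt_id' x).const_sub 1).log hx1
    convert! (DW_deriv l Q x hx).mul h1 using 1
    rw [show l + 1 / 2 = (l - 1 / 2) + 1 by ring, rpow_add_one hp.ne']
    simp only [eval_mul, eval_add, eval_one, eval_X]
    field_simp
    ring
  have hint := (intWL l hl (DW l Q)).sub (intW l hl ((1 + X) * Q))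
  have h := intervalIntegral.integral_eq_sub_of_hasDerivAt_of_tendsto (a := (-1 : ℝ)) (b := 1)
    (by norm_num) (fa := 0) (fb := 0) hd hint ?_ ?_
  · rw [intervalIntegral.integral_sub (intWL l hl (DW l Q)) (intW l hl ((1 + X) * Q))] at h
    exact sub_eq_zero.mp (h.trans (sub_zero 0))
  · have hc : ContinuousAt
        (fun x : ℝ => (1 - x ^ 2) ^ (l + 1 / 2) * Q.eval x * Real.log (1 - x)) (-1) := by
      apply ContinuousAt.mul
      · apply ContinuousAt.mul _ Q.continuous.continuousAt
        exact ContinuousAt.rpow_const (by fun_prop) (Or.inr ha.le)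
      · exact ContinuousAt.log (by fun_prop) (by norm_num)
    have := hc.tendsto
    norm_num [zero_rpow ha.ne'] at this
    exact this.mono_left nhdsWithin_le_nhds
  · have t1 : Filter.Tendsto (fun x : ℝ => 1 - x) (nhdsWithin 1 (Set.Iio 1))
        (nhdsWithin 0 (Set.Ioi 0)) := by
      apply tendsto_nhdsWithin_iff.mpr
      constructor
      · have : ContinuousAt (fun x : ℝ => 1 - x) 1 := by fun_prop
        have := this.tendsto
        rw [sub_self] at this
        exact this.mono_left nhdsWithin_le_nhds
      · filter_upwards [self_mem_nhdsWithin] with x hx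
        simpa using hx
    have t2 := (tendsto_log_mul_rpow_nhdsGT_zero ha).comp t1
    have hc : ContinuousAt (fun x : ℝ => (1 + x) ^ (l + 1 / 2) * Q.eval x) 1 := by
      apply ContinuousAt.mul _ Q.continuous.continuousAt
      exact ContinuousAt.rpow_const (by fun_prop) (Or.inr ha.le)
    have t3 := (hc.tendsto.mono_left (nhdsWithin_le_nhds (s := Set.Iio 1))).mul t2
    rw [mul_zero] at t3
    refine t3.congr' ?_
    filter_upwards [Ioo_mem_nhdsLT (show (-1 : ℝ) < 1 by norm_num)] with x hx
    simp only [Function.comp]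
    rw [show 1 - x ^ 2 = (1 + x) * (1 - x) by ring,
      mul_rpow (by linarith [hx.1]) (by linarith [hx.2])]
    ring

open Polynomial in
/-- Gegenbauer polynomials as polynomials. -/
noncomputable def GP (l : ℝ) : ℕ → ℝ[X]
  | 0 => 1
  | 1 => 2 * C l * X
  | (n + 2) => C (((n : ℝ) + 2)⁻¹) * (2 * ((n : ℝ[X]) + 1 + C l) * X * GP l (n + 1)
        - ((n : ℝ[X]) + 2 * C l) * GP l n)

open Polynomial in
lemma GP_eval (l : ℝ) (x : ℝ) (n : ℕ) : (GP l n).eval x = Geg l n x := by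
  induction n using Nat.twoStepInduction with
  | zero => simp [GP, Geg]
  | one => simp [GP, Geg]
  | more n h1 h2 =>
    simp [GP, Geg, h1, h2]
    ring

open Polynomial in
lemma GP_rec (l : ℝ) (n : ℕ) : ((n : ℝ[X]) + 2) * GP l (n + 2) =
    2 * ((n : ℝ[X]) + 1 + C l) * X * GP l (n + 1) - ((n : ℝ[X]) + 2 * C l) * GP l n := by
  have h : ((n : ℝ[X]) + 2) * C (((n : ℝ) + 2)⁻¹) = 1 := by
    have h0 : ((n : ℝ[X]) + 2) = C ((n : ℝ) + 2) := by simp [map_ofNat C 2]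
    have h1 : (n : ℝ) + 2 ≠ 0 := by positivity
    rw [h0, ← C_mul, mul_inv_cancel₀ h1, C_1]
  rw [GP, ← mul_assoc, h, one_mul]

open Polynomial in
lemma GP_ab (l : ℝ) (n : ℕ) :
    derivative (GP l (n + 1)) = ((n : ℝ[X]) + 2 * C l) * GP l n + X * derivative (GP l n) ∧
    X * derivative (GP l (n + 1)) = ((n : ℝ[X]) + 1) * GP l (n + 1) + derivative (GP l n) := by
  induction n with
  | zero =>
    constructor
    · simp [GP]
    · simp [GP]
      ring
  | succ n ih =>
    obtain ⟨ha, hb⟩ := ih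
    have hr := GP_rec l n
    have hd := congrArg derivative hr
    simp only [derivative_mul, derivative_sub, derivative_add, derivative_natCast, derivative_one,
      derivative_C, derivative_X, derivative_ofNat] at hd
    have hn : ((n : ℝ[X]) + 2) ≠ 0 := by
      have : ((n + 2 : ℕ) : ℝ[X]) ≠ 0 := Nat.cast_ne_zero.mpr (by omega)
      push_cast at this
      exact this
    have a' : derivative (GP l (n + 1 + 1)) = (((n + 1 : ℕ) : ℝ[X]) + 2 * C l) * GP l (n + 1) +
        X * derivative (GP l (n + 1)) := by
      apply mul_left_cancel₀ hn
      push_cast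
      linear_combination hd + ((n : ℝ[X]) + 2 * C l) * hb
    refine ⟨a', ?_⟩
    rw [a']
    push_cast
    linear_combination (-1) * hr - ha + X * hb

open Polynomial in
lemma GP_c (l : ℝ) (n : ℕ) : (1 - X ^ 2) * derivative (GP l n) =
    ((n : ℝ[X]) + 2 * C l) * X * GP l n - ((n : ℝ[X]) + 1) * GP l (n + 1) := by
  obtain ⟨ha, hb⟩ := GP_ab l n
  linear_combination X * ha - hb

open Polynomial in
lemma GP_d (l : ℝ) (n : ℕ) : (1 - X ^ 2) * derivative (GP l (n + 1)) =
    ((n : ℝ[X]) + 2 * C l) * GP l n - ((n : ℝ[X]) + 1) * X * GP l (n + 1) := by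
  obtain ⟨ha, hb⟩ := GP_ab l n
  linear_combination ha - X * hb

open Polynomial in
lemma GP_ode (l : ℝ) (n : ℕ) : DW l (derivative (GP l n)) =
    -((n : ℝ[X]) * ((n : ℝ[X]) + 2 * C l)) * GP l n := by
  obtain ⟨ha, hb⟩ := GP_ab l n
  have hd := congrArg derivative (GP_c l n)
  simp only [derivative_mul, derivative_sub, derivative_add, derivative_natCast, derivative_one,
      derivative_C, derivative_X, derivative_ofNat, derivative_X_pow] at hd
  rw [DW]
  simp only [map_add, map_mul, map_one, map_ofNat, Nat.cast_ofNat, Nat.add_one_sub_one, pow_one]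
    at hd ⊢
  linear_combination hd - ((n : ℝ[X]) + 1) * ha

open Polynomial in
lemma DW_wronsk (l : ℝ) (m n : ℕ) :
    DW l (derivative (GP l m) * GP l n - GP l m * derivative (GP l n)) =
      (((n : ℝ) - m) * (n + m + 2 * l)) • (GP l m * GP l n) := by
  have hm := GP_ode l m
  have hn := GP_ode l n
  rw [DW] at *
  simp only [derivative_mul, derivative_sub, smul_eq_C_mul, map_add, map_mul, map_one, map_ofNat,
    map_sub, map_natCast] at *
  linear_combination GP l n * hm - GP l m * hn

open Polynomial in
lemma DW_prod (l : ℝ) (k : ℕ) :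
    DW l (((k : ℝ) + 1 + l) • (GP l k * GP l (k + 1))) =
      (((k : ℝ) + l) * (k + 2 * l)) • (GP l k * GP l k) -
      (((k : ℝ) + 1 + l) * (k + 1)) • (GP l (k + 1) * GP l (k + 1)) -
      ((k : ℝ) + 2) • (GP l (k + 2) * GP l k) := by
  have hc := GP_c l k
  have hd := GP_d l k
  have hr := GP_rec l k
  rw [DW]
  simp only [derivative_mul, derivative_C, derivative_sub, smul_eq_C_mul, map_add, map_mul,
    map_one, map_ofNat, map_sub, map_natCast, derivative_add, derivative_natCast,
    derivative_one] at *
  linear_combination ((k : ℝ[X]) + 1 + C l) * GP l (k + 1) * hc +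
    ((k : ℝ[X]) + 1 + C l) * GP l k * hd + GP l k * hr

lemma GP_orth (l : ℝ) (hl : -(1 / 2) < l) (m n : ℕ) (hmn : m ≠ n) :
    MW l hl (GP l m * GP l n) = 0 := by
  have h := MW_DW l hl (Polynomial.derivative (GP l m) * GP l n -
    GP l m * Polynomial.derivative (GP l n))
  rw [DW_wronsk, map_smul, smul_eq_mul] at h
  refine (mul_eq_zero.mp h).resolve_left (mul_ne_zero ?_ ?_)
  · rw [sub_ne_zero]
    exact_mod_cast hmn.symm
  · have : 1 ≤ n + m := by omega
    have : (1 : ℝ) ≤ n + m := by exact_mod_cast this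
    linarith

open Polynomial in
lemma GP_deriv_two (l : ℝ) (n : ℕ) : derivative (GP l (n + 2)) =
    (2 * ((n : ℝ) + 1 + l)) • GP l (n + 1) + derivative (GP l n) := by
  have h1 := (GP_ab l (n + 1)).1
  have h2 := (GP_ab l n).2
  rw [h1, h2]
  simp only [smul_eq_C_mul, map_add, map_mul, map_one, map_ofNat, map_natCast]
  push_cast
  ring

open Polynomial in
lemma GP_orth_deriv (l : ℝ) (hl : -(1 / 2) < l) (j : ℕ) : ∀ n : ℕ, j ≤ n →
    MW l hl (derivative (GP l j) * GP l n) = 0 := by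
  induction j using Nat.twoStepInduction with
  | zero => intro n _; simp [GP]
  | one =>
    intro n hn
    have h := GP_orth l hl 0 n (by omega)
    have : derivative (GP l 1) * GP l n = (2 * l) • (GP l 0 * GP l n) := by
      simp [GP, smul_eq_C_mul, map_ofNat C 2]
    rw [this, map_smul, h, smul_zero]
  | more j h1 h2 =>
    intro n hn
    rw [GP_deriv_two, add_mul, smul_mul_assoc, map_add, map_smul, h1 n (by omega),
      GP_orth l hl _ _ (by omega)]
    simp

open Polynomial in
lemma GP_deriv_succ (l : ℝ) (hl : -(1 / 2) < l) (n : ℕ) :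
    MW l hl (derivative (GP l (n + 1)) * GP l n) = 2 * (n + l) * MW l hl (GP l n * GP l n) := by
  cases n with
  | zero =>
    have : derivative (GP l (0 + 1)) * GP l 0 = (2 * l) • (GP l 0 * GP l 0) := by
      simp [GP, smul_eq_C_mul, map_ofNat C 2]
    rw [this, map_smul]
    simp
  | succ n =>
    rw [GP_deriv_two, add_mul, smul_mul_assoc, map_add, map_smul,
      GP_orth_deriv l hl n _ (by omega)]
    simp

lemma norm_step (l : ℝ) (hl : -(1 / 2) < l) (k : ℕ) :
    ((k : ℝ) + 1 + l) * (k + 1) * MW l hl (GP l (k + 1) * GP l (k + 1)) =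
      ((k : ℝ) + l) * (k + 2 * l) * MW l hl (GP l k * GP l k) := by
  have h := MW_DW l hl (((k : ℝ) + 1 + l) • (GP l k * GP l (k + 1)))
  rw [DW_prod] at h
  simp only [map_sub, map_smul, smul_eq_mul, GP_orth l hl (k + 2) k (by omega)] at h
  linarith

open Polynomial in
lemma LW_off (l : ℝ) (hl : -(1 / 2) < l) (k : ℕ) :
    -4 * ((k : ℝ) + 1 + l) * LW l hl (GP l (k + 2) * GP l k) =
      2 * (k + l) * MW l hl (GP l k * GP l k) := by
  have h := LW_DW l hl (derivative (GP l (k + 2)) * GP l k - GP l (k + 2) * derivative (GP l k))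
  have e : (1 + X) * (derivative (GP l (k + 2)) * GP l k - GP l (k + 2) * derivative (GP l k)) =
      derivative (GP l (k + 2)) * GP l k - derivative (GP l k) * GP l (k + 2) +
      ((k : ℝ) + 2) • (GP l (k + 2) * GP l k) + derivative (GP l (k + 1)) * GP l k
      - derivative (GP l (k + 1)) * GP l (k + 2) + ((k : ℝ) + 2 * l) • (GP l k * GP l (k + 2)) := by
    have h1 := (GP_ab l (k + 1)).2
    have h2 := (GP_ab l k).1
    simp only [smul_eq_C_mul, map_add, map_mul, map_one, map_ofNat, map_natCast]
    push_cast at h1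
    linear_combination GP l k * h1 + GP l (k + 2) * h2
  have e2 : MW l hl (derivative (GP l (k + 2)) * GP l k) = 0 := by
    rw [GP_deriv_two, add_mul, smul_mul_assoc, map_add, map_smul,
      GP_orth_deriv l hl k _ le_rfl, GP_orth l hl _ _ (by omega)]
    simp
  rw [DW_wronsk, e] at h
  simp only [map_sub, map_add, map_smul, smul_eq_mul, e2, GP_orth l hl (k + 2) k (by omega),
    GP_orth l hl k (k + 2) (by omega), GP_orth_deriv l hl k (k + 2) (by omega),
    GP_orth_deriv l hl (k + 1) (k + 2) (by omega), GP_deriv_succ l hl k] at h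
  push_cast at h
  linarith

open Polynomial in
lemma LW_step (l : ℝ) (hl : -(1 / 2) < l) (k : ℕ) :
    ((k : ℝ) + l) * (k + 2 * l) * LW l hl (GP l k * GP l k) -
      ((k : ℝ) + 1 + l) * (k + 1) * LW l hl (GP l (k + 1) * GP l (k + 1)) -
      (k + 2) * LW l hl (GP l (k + 2) * GP l k) =
      ((k : ℝ) + 2 * l) / 2 * MW l hl (GP l k * GP l k) := by
  have h := LW_DW l hl (((k : ℝ) + 1 + l) • (GP l k * GP l (k + 1)))
  have e : (1 + X) * (((k : ℝ) + 1 + l) • (GP l k * GP l (k + 1))) =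
      ((k : ℝ) + 1 + l) • (GP l k * GP l (k + 1)) +
      ((1 / 2) * ((k : ℝ) + 2)) • (GP l (k + 2) * GP l k) +
      ((1 / 2) * ((k : ℝ) + 2 * l)) • (GP l k * GP l k) := by
    have hr := GP_rec l k
    have h2 : (2 : ℝ[X]) * C (1 / 2) = 1 := by
      rw [show (2 : ℝ[X]) = C 2 from (map_ofNat C 2).symm, ← C_mul]
      norm_num
    simp only [smul_eq_C_mul, map_add, map_mul, map_one, map_ofNat, map_natCast]
    linear_combination (-C (1 / 2 : ℝ)) * GP l k * hr -
      ((k : ℝ[X]) + 1 + C l) * X * GP l k * GP l (k + 1) * h2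
  rw [DW_prod, e] at h
  simp only [map_sub, map_add, map_smul, smul_eq_mul, GP_orth l hl (k + 2) k (by omega),
    GP_orth l hl k (k + 1) (by omega)] at h
  linarith

lemma k_add_ne (l : ℝ) (hl : -(1 / 2) < l) (hl0 : l ≠ 0) (k : ℕ) :
    (k : ℝ) + l ≠ 0 ∧ (k : ℝ) + 2 * l ≠ 0 := by
  cases k with
  | zero => simpa using hl0
  | succ k =>
    have : (0 : ℝ) ≤ k := k.cast_nonneg
    push_cast
    constructor <;> linarith

lemma norm_val (l : ℝ) (hl : -(1 / 2) < l) (hl0 : l ≠ 0) (k : ℕ) :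
    MW l hl (GP l k * GP l k) = MW l hl 1 *
      (l * (ascPochhammer ℝ k).eval (2 * l) / ((k.factorial : ℝ) * (k + l))) := by
  induction k with
  | zero =>
    simp [GP]
    field_simp
  | succ k ih =>
    have h := norm_step l hl k
    rw [ih] at h
    have h1 := (k_add_ne l hl hl0 k).1
    have h2 := (k_add_ne l hl hl0 (k + 1)).1
    push_cast at h2
    have h3 : (k : ℝ) + 1 ≠ 0 := by positivity
    have h4 : (k.factorial : ℝ) ≠ 0 := by positivity
    have h2' : (k : ℝ) + 1 + l ≠ 0 := h2
    rw [ascPochhammer_succ_eval, Nat.factorial_succ]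
    push_cast
    apply mul_left_cancel₀ (mul_ne_zero h2' h3)
    rw [h]
    field_simp
    ring

/-- The right-hand side of the identity. -/
noncomputable def EE (l : ℝ) (k : ℕ) : ℝ :=
  -2 * psi (2 * l + 2 * (k : ℝ)) + psi (2 * l + (k : ℝ)) + Real.log 2
        + psi (l + (k : ℝ) + 1 / 2) - 1 / (2 * (k : ℝ) + 2 * l)

lemma psi_succ' (l : ℝ) (hl : -(1 / 2) < l) (x : ℝ) (h : 2 * l ≤ x) (hx : x ≠ 0) :
    psi (x + 1) = psi x + 1 / x := by
  apply psi_add_one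
  intro m hm
  cases m with
  | zero => simp at hm; exact hx hm
  | succ m =>
    have : (0 : ℝ) ≤ m := m.cast_nonneg
    push_cast at hm
    linarith

lemma EE_zero (l : ℝ) (hl : -(1 / 2) < l) (hl0 : l ≠ 0) :
    EE l 0 = psi (l + 1 / 2) - psi (2 * l + 1) + Real.log 2 := by
  rw [psi_succ' l hl (2 * l) le_rfl (by simpa using hl0)]
  simp [EE]
  ring

lemma EE_succ (l : ℝ) (hl : -(1 / 2) < l) (hl0 : l ≠ 0) (k : ℕ) :
    EE l (k + 1) = EE l k + (1 / (k + 2 * l) - 1 / (2 * (k + l)) - 1 / (2 * (k + 1 + l))) := by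
  have hk : (0 : ℝ) ≤ k := k.cast_nonneg
  obtain ⟨h1, h2⟩ := k_add_ne l hl hl0 k
  have h3 : (k : ℝ) + 1 + l ≠ 0 := by linarith
  have h4 : 2 * l + 2 * (k : ℝ) + 1 ≠ 0 := by linarith
  have h5 : l + k + 1 / 2 ≠ 0 := by linarith
  have a1 := psi_succ' l hl (2 * l + 2 * k) (by linarith) (fun h => h1 (by linarith))
  have a2 := psi_succ' l hl (2 * l + 2 * k + 1) (by linarith) h4
  have a3 := psi_succ' l hl (2 * l + k) (by linarith) (fun h => h2 (by linarith))
  have a4 : psi (l + k + 1 / 2 + 1) = psi (l + k + 1 / 2) + 1 / (l + k + 1 / 2) := by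
    apply psi_add_one
    intro m hm
    have : (0 : ℝ) ≤ m := m.cast_nonneg
    linarith
  have e1 : 1 / (l + k + 1 / 2) = 2 * (1 / (2 * l + 2 * k + 1)) := by
    rw [show 2 * l + 2 * (k : ℝ) + 1 = 2 * (l + k + 1 / 2) by ring]
    field_simp
  have e2 : 1 / (2 * l + 2 * k) = 1 / (2 * (k + l)) := by congr 1; ring
  have e3 : 1 / (2 * l + k) = 1 / (k + 2 * l) := by congr 1; ring
  unfold EE
  push_cast
  rw [show 2 * l + 2 * ((k : ℝ) + 1) = 2 * l + 2 * k + 1 + 1 by ring,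
    show 2 * l + ((k : ℝ) + 1) = 2 * l + k + 1 by ring,
    show l + ((k : ℝ) + 1) + 1 / 2 = l + k + 1 / 2 + 1 by ring, a2, a1, a3, a4, e1, e2, e3,
    show 2 * ((k : ℝ) + 1) + 2 * l = 2 * (k + 1 + l) by ring,
    show 2 * (k : ℝ) + 2 * l = 2 * (k + l) by ring]
  have : 1 / ((k : ℝ) + l) = 2 * (1 / (2 * (k + l))) := by field_simp
  ring

lemma LW_val (l : ℝ) (hl : -(1 / 2) < l) (hl0 : l ≠ 0) (k : ℕ) :
    LW l hl (GP l k * GP l k) = MW l hl (GP l k * GP l k) * EE l k := by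
  induction k with
  | zero =>
    have hb := w_base l hl
    have h1 : LW l hl 1 = ∫ x in (-1 : ℝ)..1, (1 - x ^ 2) ^ (l - 1 / 2) * Real.log (1 - x) := by
      simp [LW]
    have h2 : MW l hl 1 = ∫ x in (-1 : ℝ)..1, (1 - x ^ 2) ^ (l - 1 / 2) := by
      simp [MW]
    rw [EE_zero l hl hl0]
    simp only [GP, mul_one]
    rw [h1, h2, hb.2.2.1, hb.2.2.2]
  | succ k ih =>
    have hs := LW_step l hl k
    have ho := LW_off l hl k
    have hn := norm_step l hl k
    have hk : (0 : ℝ) ≤ k := k.cast_nonneg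
    obtain ⟨h1, h2⟩ := k_add_ne l hl hl0 k
    have h3 : (k : ℝ) + 1 + l ≠ 0 := by linarith
    have h4 : (k : ℝ) + 1 ≠ 0 := by positivity
    have ho' : LW l hl (GP l (k + 2) * GP l k) =
        -((k + l) * MW l hl (GP l k * GP l k)) / (2 * (k + 1 + l)) := by
      rw [eq_div_iff (by simpa using h3)]
      linarith
    rw [ih, ho'] at hs
    rw [EE_succ l hl hl0]
    apply mul_left_cancel₀ (mul_ne_zero h3 h4)
    rw [← mul_assoc, hn]
    have : ((k : ℝ) + 1 + l) * (k + 1) * LW l hl (GP l (k + 1) * GP l (k + 1)) =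
      (k + l) * (k + 2 * l) * (MW l hl (GP l k * GP l k) * EE l k) -
        (k + 2) * (-((k + l) * MW l hl (GP l k * GP l k)) / (2 * (k + 1 + l))) -
        (k + 2 * l) / 2 * MW l hl (GP l k * GP l k) := by linarith
    rw [this]
    have S : ((k : ℝ) + l) * (k + 2 * l) *
        (1 / (k + 2 * l) - 1 / (2 * (k + l)) - 1 / (2 * (k + 1 + l))) =
        (k + 2) * ((k + l) / (2 * (k + 1 + l))) - (k + 2 * l) / 2 := by
      generalize hu : (k : ℝ) + 2 * l = u at *
      generalize hv : (k : ℝ) + l = v at *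
      generalize hw : (k : ℝ) + 1 + l = w at *
      have e1 : u = 2 * v - k := by linarith
      have e2 : w = v + 1 := by linarith
      field_simp
      rw [e1, e2]
      ring
    linear_combination (-MW l hl (GP l k * GP l k)) * S

lemma MW_one (l : ℝ) (hl : -(1 / 2) < l) :
    MW l hl 1 = √π * Gamma (l + 1 / 2) / Gamma (l + 1) := by
  have hb := (w_base l hl).2.2.1
  have h2 : MW l hl 1 = ∫ x in (-1 : ℝ)..1, (1 - x ^ 2) ^ (l - 1 / 2) := by
    simp [MW]
  have hd := Gamma_mul_Gamma_add_half (l + 1 / 2)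
  rw [show l + 1 / 2 + 1 / 2 = l + 1 by ring, show 2 * (l + 1 / 2) = 2 * l + 1 by ring,
    show 1 - (2 * l + 1) = -(2 * l) by ring, rpow_neg (by norm_num)] at hd
  have g1 := (Gamma_pos_of_pos (show 0 < l + 1 by linarith)).ne'
  have g2 := (Gamma_pos_of_pos (show 0 < 2 * l + 1 by linarith)).ne'
  have g3 : (2 : ℝ) ^ (2 * l) ≠ 0 := (rpow_pos_of_pos two_pos _).ne'
  rw [h2, hb]
  generalize Gamma (l + 1 / 2) = G1 at *
  generalize Gamma (l + 1) = G2 at *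
  generalize Gamma (2 * l + 1) = G3 at *
  generalize (2 : ℝ) ^ (2 * l) = T at *
  have hd' : G1 * G2 * T = G3 * √π := by
    rw [hd]
    field_simp
  rw [← mul_div_assoc, div_eq_div_iff g2 g1]
  linear_combination G1 * hd'

lemma Gamma_poch (l : ℝ) (hl : -(1 / 2) < l) (hl0 : l ≠ 0) (k : ℕ) :
    Gamma (2 * l + k) = (ascPochhammer ℝ k).eval (2 * l) * Gamma (2 * l) := by
  induction k with
  | zero => simp
  | succ k ih =>
    have h := (k_add_ne l hl hl0 k).2
    push_cast
    rw [← add_assoc, Gamma_add_one (by rwa [add_comm]), ih, ascPochhammer_succ_eval]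
    ring

lemma MW_sq_nonneg (l : ℝ) (hl : -(1 / 2) < l) (k : ℕ) : 0 ≤ MW l hl (GP l k * GP l k) := by
  apply intervalIntegral.integral_nonneg (by norm_num)
  intro x hx
  rw [Polynomial.eval_mul]
  refine mul_nonneg (mul_self_nonneg _) (rpow_nonneg ?_ _)
  nlinarith [hx.1, hx.2]

theorem gegenbauer_log_integral
    (lam : ℝ) (hlam : -(1 / 2) < lam) (hlam0 : lam ≠ 0) (k : ℕ) :
    (∫ x in Set.Icc (-1 : ℝ) 1, GegHat lam k x ^ 2 * wG lam x * Real.log (1 - x)) =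
      -2 * psi (2 * lam + 2 * (k : ℝ)) + psi (2 * lam + (k : ℝ)) + Real.log 2
        + psi (lam + (k : ℝ) + 1 / 2) - 1 / (2 * (k : ℝ) + 2 * lam) ∧
    (∫ x in Set.Icc (-1 : ℝ) 1,
        Geg lam k x ^ 2 * (1 - x ^ 2) ^ (lam - 1 / 2) * Real.log (1 - x)) =
      Real.pi * (2 : ℝ) ^ (1 - 2 * lam) * Real.Gamma (2 * lam + (k : ℝ)) /
          ((k.factorial : ℝ) * ((k : ℝ) + lam) * Real.Gamma lam ^ 2) *
        (-2 * psi (2 * lam + 2 * (k : ℝ)) + psi (2 * lam + (k : ℝ)) + Real.log 2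
          + psi (lam + (k : ℝ) + 1 / 2) - 1 / (2 * (k : ℝ) + 2 * lam)) := by
  have hLW : (∫ x in Set.Icc (-1 : ℝ) 1,
        Geg lam k x ^ 2 * (1 - x ^ 2) ^ (lam - 1 / 2) * Real.log (1 - x)) =
      LW lam hlam (GP lam k * GP lam k) := by
    rw [integral_Icc_eq_integral_Ioc, ← intervalIntegral.integral_of_le (by norm_num)]
    simp only [LW, LinearMap.coe_mk, AddHom.coe_mk, Polynomial.eval_mul, GP_eval]
    congr 1
    ext x
    ring
  have hval := LW_val lam hlam hlam0 k
  have hnorm := norm_val lam hlam hlam0 k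
  have hM1 := MW_one lam hlam
  have g1 := Gamma_pos_of_pos (show 0 < lam + 1 by linarith)
  have g2 := Gamma_pos_of_pos (show 0 < lam + 1 / 2 by linarith)
  have hpi : 0 < √π := Real.sqrt_pos.mpr Real.pi_pos
  have hM1pos : 0 < MW lam hlam 1 := by
    rw [hM1]
    positivity
  obtain ⟨n1, n2⟩ := k_add_ne lam hlam hlam0 k
  have hf : (k.factorial : ℝ) ≠ 0 := by positivity
  have ngl : Gamma lam ≠ 0 := by
    intro h
    rw [Gamma_add_one hlam0, h, mul_zero] at g1
    exact lt_irrefl _ g1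
  have hG := Gamma_poch lam hlam hlam0 k
  have hGk : Gamma (2 * lam) ≠ 0 := by
    have : 0 < Gamma (2 * lam + 1) := Gamma_pos_of_pos (by linarith)
    rw [Gamma_add_one (by simpa using hlam0)] at this
    intro h
    rw [h, mul_zero] at this
    exact lt_irrefl _ this
  have hp : (ascPochhammer ℝ k).eval (2 * lam) ≠ 0 := by
    intro h
    rw [h, zero_mul] at hG
    refine Gamma_ne_zero (s := 2 * lam + k) (fun m hm => ?_) hG
    have hk0 : (0 : ℝ) ≤ k := k.cast_nonneg
    cases m with
    | zero => exact n2 (by simp at hm; linarith)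
    | succ m =>
      have : (0 : ℝ) ≤ m := m.cast_nonneg
      push_cast at hm
      linarith
  change _ = EE lam k ∧ _ = _ * EE lam k
  constructor
  · have hfun : ∀ x : ℝ, GegHat lam k x ^ 2 * wG lam x * Real.log (1 - x) =
        (gamG lam k ^ 2 * (Real.Gamma (lam + 1) / (√π * Real.Gamma (lam + 1 / 2)))) *
        (Geg lam k x ^ 2 * (1 - x ^ 2) ^ (lam - 1 / 2) * Real.log (1 - x)) := by
      intro x
      unfold GegHat wG
      ring
    simp_rw [hfun]
    rw [integral_const_mul, hLW, hval]
    have hq : 0 ≤ lam * (ascPochhammer ℝ k).eval (2 * lam) / ((k.factorial : ℝ) * (k + lam)) := by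
      have := MW_sq_nonneg lam hlam k
      rw [hnorm] at this
      exact nonneg_of_mul_nonneg_right this hM1pos
    have hg : gamG lam k ^ 2 = (k.factorial : ℝ) * ((k : ℝ) + lam) /
        (lam * (ascPochhammer ℝ k).eval (2 * lam)) := by
      unfold gamG
      rw [Real.sq_sqrt]
      rw [← inv_div]
      exact inv_nonneg.mpr hq
    rw [hg, hnorm, hM1]
    generalize Gamma (lam + 1 / 2) = G1 at *
    generalize Gamma (lam + 1) = G2 at *
    generalize (ascPochhammer ℝ k).eval (2 * lam) = q at *
    have g1' := g1.ne'
    have g2' := g2.ne'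
    have hpi' := hpi.ne'
    field_simp
  · rw [hLW, hval, hnorm, hM1, hG]
    congr 1
    have hd := Gamma_mul_Gamma_add_half lam
    rw [Gamma_add_one hlam0]
    have hs : √π * √π = π := Real.mul_self_sqrt Real.pi_pos.le
    generalize Gamma (lam + 1 / 2) = G1 at *
    generalize (ascPochhammer ℝ k).eval (2 * lam) = q at *
    generalize Gamma (2 * lam) = G4 at *
    generalize (2 : ℝ) ^ (1 - 2 * lam) = T at *
    generalize Gamma lam = G0 at *
    have hG1 : G1 = G4 * T * √π / G0 := by
      rw [eq_div_iff ngl]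
      linarith
    rw [hG1]
    generalize √π = r at hs ⊢
    rw [← hs]
    field_simp
end

section
/- The quantity Σ_{j=1}^{n} j·log j - ( (1/2)·n²·log n - (1/4)·n² + (1/2)·n·log n + (1/12)·log n ) is bounded as n → ∞; that is, there exist constants C > 0 and N such that | Σ_{j=1}^{n} j·log j - (1/2)·n²·log n + (1/4)·n² - (1/2)·n·log n - (1/12)·log n | ≤ C for all n ≥ N. -/
open Real Finset

lemma step_bound (m : ℝ) (hm : 2 ≤ m) :
    |(m ^ 2 / 2 - m / 2 + 1 / 12) * Real.log (1 - 1 / m) + (2 * m - 1) / 4| ≤ 2 / m ^ 2 := by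
  have hm0 : 0 < m := by linarith
  obtain ⟨x, hx⟩ : ∃ x, x = 1 / m := ⟨_, rfl⟩
  have hx0 : 0 < x := by rw [hx]; positivity
  have hx2 : x ≤ 1 / 2 := by rw [hx]; exact one_div_le_one_div_of_le (by norm_num) hm
  have hmx : m * x = 1 := by rw [hx]; field_simp
  have h := Real.abs_log_sub_add_sum_range_le (x := x) (by rw [abs_of_pos hx0]; linarith) 3
  rw [abs_of_pos hx0] at h
  have h2 : x ^ (3 + 1) / (1 - x) ≤ 2 * x ^ 4 := by
    rw [div_le_iff₀ (by linarith)]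
    have := mul_nonneg (pow_pos hx0 4).le (by linarith : 0 ≤ 1 - 2 * x)
    norm_num
    linarith
  have h3 := h.trans h2
  norm_num [Finset.sum_range_succ] at h3
  obtain ⟨R, hR⟩ : ∃ R, R = x + x ^ 2 / 2 + x ^ 3 / 3 + Real.log (1 - x) := ⟨_, rfl⟩
  have hRb : |R| ≤ 2 * x ^ 4 := by
    rw [hR]; convert h3 using 2
  have hlog : Real.log (1 - x) = R - (x + x ^ 2 / 2 + x ^ 3 / 3) := by rw [hR]; ring
  have e : (m ^ 2 / 2 - m / 2 + 1 / 12) * Real.log (1 - 1 / m) + (2 * m - 1) / 4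
      = (m ^ 2 / 2 - m / 2 + 1 / 12) * R + (x ^ 2 / 8 - x ^ 3 / 36) := by
    rw [← hx, hlog]
    have : m = 1 / x := by rw [hx]; field_simp
    rw [this]; field_simp; ring
  have hA : |(m ^ 2 / 2 - m / 2 + 1 / 12) * R| ≤ x ^ 2 := by
    rw [abs_mul, abs_of_nonneg (by nlinarith)]
    calc _ ≤ (m ^ 2 / 2) * (2 * x ^ 4) := by
          apply mul_le_mul _ hRb (abs_nonneg _) (by positivity)
          linarith
      _ = (m * x) ^ 2 * x ^ 2 := by ring
      _ = x ^ 2 := by rw [hmx]; ring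
  have hB : 2 / m ^ 2 = 2 * x ^ 2 := by rw [hx]; field_simp
  have h4 : x ^ 3 ≤ x ^ 2 := by nlinarith [pow_pos hx0 2]
  have h5 := pow_pos hx0 3
  rw [e, hB]
  rw [abs_le] at hA ⊢
  constructor <;> linarith [hA.1, hA.2]

theorem sum_j_log_j_asymptotics :
    ∃ C > (0 : ℝ), ∃ N : ℕ, ∀ n : ℕ, N ≤ n →
      |(∑ j ∈ Finset.Icc 1 n, (j : ℝ) * Real.log j)
          - (1 / 2) * (n : ℝ) ^ 2 * Real.log n + (1 / 4) * (n : ℝ) ^ 2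
          - (1 / 2) * (n : ℝ) * Real.log n - (1 / 12) * Real.log n| ≤ C := by
  refine ⟨3, by norm_num, 1, fun n hn => ?_⟩
  suffices H : |(∑ j ∈ Finset.Icc 1 n, (j : ℝ) * Real.log j)
          - (1 / 2) * (n : ℝ) ^ 2 * Real.log n + (1 / 4) * (n : ℝ) ^ 2
          - (1 / 2) * (n : ℝ) * Real.log n - (1 / 12) * Real.log n| ≤ 3 - 2 / (n : ℝ) by
    have : 0 ≤ 2 / (n : ℝ) := by positivity
    linarith
  induction n, hn using Nat.le_induction with
  | base => norm_num [abs_le]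
  | succ n hn ih =>
    rw [Finset.sum_Icc_succ_top (by omega)]
    have hn1 : (1 : ℝ) ≤ n := by exact_mod_cast hn
    have hn0 : (0 : ℝ) < n := by linarith
    have hs := step_bound ((n : ℝ) + 1) (by linarith)
    have hl : Real.log (1 - 1 / ((n : ℝ) + 1)) = Real.log n - Real.log ((n : ℝ) + 1) := by
      rw [← Real.log_div (by positivity) (by positivity)]
      congr 1
      field_simp
      ring
    rw [hl] at hs
    have hb : 2 / ((n : ℝ) + 1) ^ 2 ≤ 2 / n - 2 / ((n : ℝ) + 1) := by
      rw [div_sub_div _ _ (by positivity) (by positivity),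
        div_le_div_iff₀ (by positivity) (by positivity)]
      nlinarith
    push_cast
    generalize ∑ j ∈ Finset.Icc 1 n, (j : ℝ) * Real.log j = S at *
    rw [abs_le] at *
    constructor <;> nlinarith [hs.1, hs.2, ih.1, ih.2]
end

section
/- For every integer n ≥ 2: Σ_{k=2}^{n} H_{2k-1} = n·H_{2n-1} + H_{2n}/2 - H_n/4 - n - 1/2. -/
open Real Finset

theorem H_succ_aux (n : ℕ) : H (n + 1) = H n + 1 / ((n : ℝ) + 1) := by
  unfold H
  rw [Finset.sum_Icc_succ_top (by omega)]
  push_cast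
  ring

theorem harmonic_odd_sum (n : ℕ) (hn : 2 ≤ n) :
    (∑ k ∈ Finset.Icc 2 n, H (2 * k - 1)) =
      (n : ℝ) * H (2 * n - 1) + H (2 * n) / 2 - H n / 4 - (n : ℝ) - 1 / 2 := by
  induction n, hn using Nat.le_induction with
  | base =>
    simp [H, Finset.sum_Icc_succ_top]
    norm_num
  | succ m hm ih =>
    rw [Finset.sum_Icc_succ_top (by omega), ih]
    obtain ⟨j, rfl⟩ : ∃ j, m = j + 1 := ⟨m - 1, by omega⟩
    have e1 : 2 * (j + 1) - 1 = 2 * j + 1 := by omega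
    have e2 : 2 * (j + 1 + 1) - 1 = 2 * j + 1 + 1 + 1 := by omega
    have e3 : 2 * (j + 1) = 2 * j + 1 + 1 := by omega
    have e4 : 2 * (j + 1 + 1) = 2 * j + 1 + 1 + 1 + 1 := by omega
    rw [e1, e2, e3, e4, H_succ_aux (2 * j + 1 + 1 + 1), H_succ_aux (2 * j + 1 + 1),
      H_succ_aux (2 * j + 1), H_succ_aux (j + 1)]
    generalize H (2 * j + 1) = a
    generalize H (j + 1) = b
    have h0 : (0 : ℝ) ≤ j := Nat.cast_nonneg j
    push_cast
    have h1 : (2 * (j : ℝ) + 1 + 1) ≠ 0 := by positivity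
    have h2 : (2 * (j : ℝ) + 1 + 1 + 1) ≠ 0 := by positivity
    have h3 : (2 * (j : ℝ) + 1 + 1 + 1 + 1) ≠ 0 := by positivity
    have h4 : ((j : ℝ) + 1 + 1) ≠ 0 := by positivity
    have q1 : 1 / (2 * (j : ℝ) + 1 + 1 + 1 + 1) = 1 / ((j : ℝ) + 1 + 1) / 2 := by
      field_simp
      ring
    rw [q1]
    field_simp
    ring
end
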